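/- arXiv:1505.02081 — 10 statements merged into one kernel-verified Lean document; each statement's English description precedes it below -/
import Mathlib

section
/- Let Γ be a finite simple graph with vertex set V, let k be a field, and let S ⊆ V be nonempty. Then ⋂_{s∈S} A_s(Γ,k) ≠ ∅ if and only if S is a clique of Γ (any two distinct elements of S are adjacent; singletons are cliques). Moreover, if S is a clique and k = F_q is the finite field with q elements, then |⋂_{s∈S} A_s(Γ,F_q)| = (q−1)^{|S|−1} · q^{c(S)}, where c(S) = #{ w ∈ V∖S : w is adjacent to every element of S }. -/
/-- The affine chart `A_v(Γ,k)` attached to a vertex `v` of a simple graph. -/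
def Achart {V : Type*} (G : SimpleGraph V) (k : Type*) [Field k] (v : V) :
    Set (Projectivization k (V → k)) :=
  {p | ∃ (x : V → k) (hx : x ≠ 0), p = Projectivization.mk k x hx ∧
    x v ≠ 0 ∧ ∀ w : V, ¬ (w = v ∨ G.Adj v w) → x w = 0}

theorem mk_mem_Achart_iff {V : Type*} {G : SimpleGraph V} {k : Type*} [Field k] {v : V}
    {x : V → k} {hx : x ≠ 0} :
    Projectivization.mk k x hx ∈ Achart G k v ↔
      x v ≠ 0 ∧ ∀ w : V, ¬ (w = v ∨ G.Adj v w) → x w = 0 := by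
  constructor
  · rintro ⟨y, hy, hxy, hv, hw⟩
    obtain ⟨a, rfl⟩ := (Projectivization.mk_eq_mk_iff' k x y hx hy).1 hxy
    have ha : a ≠ 0 := by
      rintro rfl
      simp at hx
    exact ⟨mul_ne_zero ha hv, fun w h => by simp [hw w h]⟩
  · rintro ⟨hv, hw⟩
    exact ⟨x, hx, rfl, hv, hw⟩

theorem iInter_Achart_nonempty_iff {V : Type*} (G : SimpleGraph V) (k : Type*) [Field k]
    (S : Finset V) (hS : S.Nonempty) :
    (⋂ s ∈ S, Achart G k s).Nonempty ↔ G.IsClique (S : Set V) := by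
  classical
  constructor
  · rintro ⟨p, hp⟩ s hs t ht hst
    induction p using Projectivization.ind with
    | h x hx =>
      simp only [Set.mem_iInter, mk_mem_Achart_iff] at hp
      by_contra h
      refine (hp t ht).1 ((hp s hs).2 t ?_)
      rintro (rfl | h')
      · exact hst rfl
      · exact h h'
  · intro h
    obtain ⟨s₀, hs₀⟩ := hS
    have hx : (fun w => if w ∈ S then (1 : k) else 0) ≠ 0 := fun h0 => by
      simpa [hs₀] using congrFun h0 s₀
    refine ⟨Projectivization.mk k _ hx, ?_⟩
    simp only [Set.mem_iInter, mk_mem_Achart_iff]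
    refine fun s hs => ⟨by simp [hs], fun w hw => if_neg fun hwS => hw ?_⟩
    by_cases hws : w = s
    · exact Or.inl hws
    · exact Or.inr (h hs hwS (Ne.symm hws))

/-- The representatives, normalised to be `1` at `s₀`, of the points lying in all the charts
attached to the vertices of a clique `S` containing `s₀`. -/
def normalizedReps {V : Type*} [Fintype V] [DecidableEq V] (G : SimpleGraph V)
    [DecidableRel G.Adj] (K : Type*) [Field K] [Fintype K] [DecidableEq K]
    (S : Finset V) (s₀ : V) : Finset (V → K) :=
  Fintype.piFinset fun w =>
    if w = s₀ then {1} else if w ∈ S then Finset.univ.erase 0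
    else if ∀ s ∈ S, G.Adj s w then Finset.univ else {0}

theorem card_normalizedReps {V : Type*} [Fintype V] [DecidableEq V] (G : SimpleGraph V)
    [DecidableRel G.Adj] (K : Type*) [Field K] [Fintype K] [DecidableEq K]
    {S : Finset V} {s₀ : V} (hs₀ : s₀ ∈ S) :
    (normalizedReps G K S s₀).card = (Fintype.card K - 1) ^ (S.card - 1) *
      Fintype.card K ^ (Finset.univ.filter (fun w => w ∉ S ∧ ∀ s ∈ S, G.Adj s w)).card := by
  rw [normalizedReps, Fintype.card_piFinset, ← Finset.card_erase_of_mem hs₀,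
    ← Finset.prod_const, ← Finset.prod_const, Finset.prod_filter,
    ← Finset.filter_univ_mem (S.erase s₀), Finset.prod_filter, ← Finset.prod_mul_distrib]
  refine Finset.prod_congr rfl fun w _ => ?_
  by_cases h₀ : w = s₀
  · subst h₀
    simp [hs₀]
  · by_cases hw : w ∈ S
    · simp [h₀, hw, Finset.card_erase_of_mem]
    · by_cases hc : ∀ s ∈ S, G.Adj s w
      · simp [h₀, hw, if_pos hc]
      · simp [h₀, hw, if_neg hc]

theorem ncard_iInter_Achart {V : Type*} [Fintype V] [DecidableEq V] (G : SimpleGraph V)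
    [DecidableRel G.Adj] (K : Type*) [Field K] [Fintype K] [DecidableEq K]
    {S : Finset V} (hS : G.IsClique (S : Set V)) {s₀ : V} (hs₀ : s₀ ∈ S) :
    (⋂ s ∈ S, Achart G K s).ncard = (normalizedReps G K S s₀).card := by
  have hone : ∀ x ∈ normalizedReps G K S s₀, x s₀ = 1 := fun x hx => by
    simpa using Fintype.mem_piFinset.1 hx s₀
  have hne : ∀ x ∈ normalizedReps G K S s₀, x ≠ 0 := by
    rintro x hx rfl
    simpa using hone _ hx
  rw [← Set.ncard_coe_finset]
  symm
  refine Set.ncard_congr (fun x hx => Projectivization.mk K x (hne x hx)) ?_ ?_ ?_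
  · intro x hx
    simp only [Set.mem_iInter, mk_mem_Achart_iff]
    have hx' := Fintype.mem_piFinset.1 (Finset.mem_coe.1 hx)
    intro s hs
    refine ⟨?_, fun w hw => ?_⟩
    · by_cases h₀ : s = s₀
      · subst h₀
        simp [hone x hx]
      · simpa [h₀, hs] using hx' s
    · have hwS : w ∉ S := fun hwS => hw <| by
        by_cases hws : w = s
        · exact Or.inl hws
        · exact Or.inr (hS hs hwS (Ne.symm hws))
      have h₀ : w ≠ s₀ := by
        rintro rfl
        exact hwS hs₀
      have hc : ¬ ∀ t ∈ S, G.Adj t w := fun hc => hw (Or.inr (hc s hs))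
      have hxw := hx' w
      rw [if_neg h₀, if_neg hwS, if_neg hc] at hxw
      simpa using hxw
  · intro x y hx hy hxy
    obtain ⟨a, rfl⟩ := (Projectivization.mk_eq_mk_iff' K x y _ _).1 hxy
    have ha : a = 1 := by
      simpa [hone y hy] using hone _ hx
    simp [ha]
  · intro p hp
    induction p using Projectivization.ind with
    | h x hx =>
      simp only [Set.mem_iInter, mk_mem_Achart_iff] at hp
      have hx₀ := (hp s₀ hs₀).1
      refine ⟨(x s₀)⁻¹ • x, ?_, (Projectivization.mk_eq_mk_iff' K _ _ _ _).2 ⟨_, rfl⟩⟩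
      refine Finset.mem_coe.2 (Fintype.mem_piFinset.2 fun w => ?_)
      by_cases h₀ : w = s₀
      · subst h₀
        simp [hx₀]
      · by_cases hw : w ∈ S
        · simp [h₀, hw, hx₀, (hp w hw).1]
        · by_cases hc : ∀ s ∈ S, G.Adj s w
          · rw [if_neg h₀, if_neg hw, if_pos hc]
            exact Finset.mem_univ _
          · rw [if_neg h₀, if_neg hw, if_neg hc]
            push Not at hc
            obtain ⟨s, hs, hsw⟩ := hc
            have : x w = 0 := (hp s hs).2 w <| by
              rintro (rfl | h)
              · exact hw hs
              · exact hsw h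
            simp [this]

/-- for a nonempty set `S` of vertices, `⋂_{s∈S} A_s(Γ,k) ≠ ∅` iff `S` is a
clique of `Γ`; and if `S` is a clique and `F_q` is a finite field with `q` elements,
then `|⋂_{s∈S} A_s(Γ,F_q)| = (q−1)^{|S|−1} · q^{c(S)}`, where `c(S)` is the number of
vertices outside `S` adjacent to every element of `S`. -/
theorem stmt2 {V : Type*} [Fintype V] [DecidableEq V] (G : SimpleGraph V)
    [DecidableRel G.Adj] (k : Type*) [Field k] (S : Finset V) (hS : S.Nonempty) :
    ((⋂ s ∈ S, Achart G k s) ≠ ∅ ↔ G.IsClique (S : Set V)) ∧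
    (G.IsClique (S : Set V) →
      ∀ (K : Type) [Field K] [Fintype K] (q : ℕ), Fintype.card K = q →
        (((⋂ s ∈ S, Achart G K s).ncard : ℤ) =
          ((q : ℤ) - 1) ^ (S.card - 1) *
            (q : ℤ) ^ ((Finset.univ.filter
              (fun w => w ∉ S ∧ ∀ s ∈ S, G.Adj s w)).card))) := by
  refine ⟨Set.nonempty_iff_ne_empty.symm.trans (iInter_Achart_nonempty_iff G k S hS), ?_⟩
  rintro hclique K _ _ q rfl
  classical
  obtain ⟨s₀, hs₀⟩ := hS
  rw [ncard_iInter_Achart G K hclique hs₀, card_normalizedReps G K hs₀]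
  push_cast [Nat.cast_sub (Fintype.card_pos (α := K))]
  simp
end

section
/- Let Γ be a finite simple graph with vertex set V and let F_q be a finite field with q elements. Then |S_{F_q}(Γ)| = Σ_{S} (−1)^{|S|+1} (q−1)^{|S|−1} q^{c(S)}, where the sum ranges over all nonempty cliques S of Γ and c(S) = #{ w ∈ V∖S : w is adjacent to every element of S }. -/
/-- `S_k(Γ) = ⋃_{v ∈ V} A_v(Γ,k)`. -/
def Spts {V : Type*} (G : SimpleGraph V) (k : Type*) [Field k] :
    Set (Projectivization k (V → k)) :=
  ⋃ v : V, Achart G k v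

/-- The cone over `A_v(Γ,k)`: representatives of its points, as a finset of functions. -/
def chartCone {V : Type*} [Fintype V] [DecidableEq V] (G : SimpleGraph V)
    [DecidableRel G.Adj] (K : Type*) [Field K] [Fintype K] [DecidableEq K] (v : V) :
    Finset (V → K) :=
  Finset.univ.filter fun x => x v ≠ 0 ∧ ∀ w : V, ¬ (w = v ∨ G.Adj v w) → x w = 0

section

variable {V : Type*} [Fintype V] [DecidableEq V] (G : SimpleGraph V)
  [DecidableRel G.Adj] (K : Type*) [Field K] [Fintype K] [DecidableEq K]

lemma mem_chartCone {v : V} {x : V → K} : x ∈ chartCone G K v ↔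
    x v ≠ 0 ∧ ∀ w : V, ¬ (w = v ∨ G.Adj v w) → x w = 0 := by
  simp [chartCone]

lemma smul_mem_chartCone {v : V} {x : V → K} (u : Kˣ) (hx : x ∈ chartCone G K v) :
    u • x ∈ chartCone G K v := by
  rw [mem_chartCone] at hx ⊢
  refine ⟨?_, fun w hw => ?_⟩
  · simpa [Units.smul_def] using hx.1
  · simpa [Units.smul_def] using hx.2 w hw

lemma mem_Achart_iff_rep {v : V} {p : Projectivization K (V → K)} :
    p ∈ Achart G K v ↔ p.rep ∈ chartCone G K v := by
  constructor
  · rintro ⟨x, hx, rfl, h⟩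
    obtain ⟨u, hu⟩ := Projectivization.exists_smul_eq_mk_rep K x hx
    rw [← hu]
    exact smul_mem_chartCone G K u ((mem_chartCone G K).2 h)
  · intro h
    exact ⟨p.rep, p.rep_nonzero, p.mk_rep.symm, (mem_chartCone G K).1 h⟩

lemma card_biUnion_chartCone :
    (Finset.univ.biUnion (chartCone G K)).card = (Spts G K).ncard * (Fintype.card K - 1) := by
  have himage : ((Finset.univ.biUnion (chartCone G K) : Finset (V → K)) : Set (V → K)) =
      (fun z : Projectivization K (V → K) × Kˣ => z.2 • z.1.rep) ''
        (Spts G K ×ˢ Set.univ) := by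
    ext x
    simp only [Finset.coe_biUnion, Set.mem_iUnion, Set.mem_image, Set.mem_prod, Spts,
      mem_Achart_iff_rep, Finset.mem_coe, Finset.mem_univ, Set.mem_univ, and_true, exists_prop,
      true_and, Prod.exists]
    constructor
    · rintro ⟨v, hv⟩
      have hx : x ≠ 0 := by
        rintro rfl
        exact ((mem_chartCone G K).1 hv).1 rfl
      obtain ⟨u, hu⟩ := Projectivization.exists_smul_eq_mk_rep K x hx
      refine ⟨Projectivization.mk K x hx, u⁻¹, ⟨v, ?_⟩, ?_⟩
      · rw [← hu]
        exact smul_mem_chartCone G K u hv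
      · rw [← hu, inv_smul_smul]
    · rintro ⟨p, u, ⟨v, hv⟩, rfl⟩
      exact ⟨v, smul_mem_chartCone G K u hv⟩
  have hinj : Function.Injective
      (fun z : Projectivization K (V → K) × Kˣ => z.2 • z.1.rep) := by
    rintro ⟨p, u⟩ ⟨r, t⟩ h
    dsimp only at h
    obtain rfl : p = r := by
      rw [← p.mk_rep, ← r.mk_rep, Projectivization.mk_eq_mk_iff]
      exact ⟨u⁻¹ * t, by rw [mul_smul, ← h, inv_smul_smul]⟩
    have : u = t := by
      apply Units.ext
      exact smul_left_injective K p.rep_nonzero h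
    rw [this]
  rw [← Set.ncard_coe_finset, himage, Set.ncard_image_of_injective _ hinj, Set.ncard_prod,
    Set.ncard_univ, Nat.card_eq_fintype_card, Fintype.card_units]

lemma inf_chartCone_of_isClique {S : Finset V} (hS : S.Nonempty)
    (hc : ∀ a ∈ S, ∀ b ∈ S, a ≠ b → G.Adj a b) :
    S.inf' hS (chartCone G K) = Fintype.piFinset fun w =>
      if w ∈ S then Finset.univ.erase (0 : K)
      else if ∀ s ∈ S, G.Adj s w then Finset.univ else {0} := by
  ext x
  simp only [Finset.mem_inf', mem_chartCone, Fintype.mem_piFinset]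
  constructor
  · intro h w
    split_ifs with h1 h2
    · simpa using (h w h1).1
    · simp
    · push Not at h2
      obtain ⟨s, hs, hsw⟩ := h2
      have : ¬ (w = s ∨ G.Adj s w) := by
        rintro (rfl | h3)
        · exact h1 hs
        · exact hsw h3
      simpa using (h s hs).2 w this
  · intro h v hv
    refine ⟨by simpa [hv] using h v, fun w hw => ?_⟩
    push Not at hw
    have h1 : w ∉ S := fun h1 => hw.2 (hc v hv w h1 hw.1.symm)
    have h2 : ¬ ∀ s ∈ S, G.Adj s w := fun h2 => hw.2 (h2 v hv)
    simpa [h1, h2] using h w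

lemma card_inf_chartCone_of_isClique {S : Finset V} (hS : S.Nonempty)
    (hc : ∀ a ∈ S, ∀ b ∈ S, a ≠ b → G.Adj a b) :
    (S.inf' hS (chartCone G K)).card = (Fintype.card K - 1) ^ S.card *
      Fintype.card K ^ (Finset.univ.filter (fun w => w ∉ S ∧ ∀ s ∈ S, G.Adj s w)).card := by
  rw [inf_chartCone_of_isClique G K hS hc, Fintype.card_piFinset]
  simp only [apply_ite Finset.card, Finset.card_erase_of_mem (Finset.mem_univ _),
    Finset.card_univ, Finset.card_singleton]
  rw [Finset.prod_ite, Finset.prod_ite]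
  simp [Finset.filter_filter]

lemma inf_chartCone_eq_empty {S : Finset V} (hS : S.Nonempty)
    (hc : ¬ ∀ a ∈ S, ∀ b ∈ S, a ≠ b → G.Adj a b) :
    S.inf' hS (chartCone G K) = ∅ := by
  push Not at hc
  obtain ⟨a, ha, b, hb, hab, hadj⟩ := hc
  rw [Finset.eq_empty_iff_forall_notMem]
  intro x hx
  simp only [Finset.mem_inf', mem_chartCone] at hx
  refine (hx b hb).1 ((hx a ha).2 b ?_)
  rintro (rfl | h)
  · exact hab rfl
  · exact hadj h

end

/-- inclusion-exclusion formula for the number of `F_q`-points: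
`|S_{F_q}(Γ)| = Σ_S (−1)^{|S|+1} (q−1)^{|S|−1} q^{c(S)}`, the sum over all nonempty
cliques `S` of `Γ`, where `c(S)` is the number of vertices outside `S` adjacent to every
element of `S`. -/
theorem stmt3 {V : Type*} [Fintype V] [DecidableEq V] (G : SimpleGraph V)
    [DecidableRel G.Adj] (K : Type*) [Field K] [Fintype K] (q : ℕ)
    (hq : Fintype.card K = q) :
    ((Spts G K).ncard : ℤ) =
      ∑ S ∈ (Finset.univ : Finset V).powerset.filter
          (fun S => S.Nonempty ∧ ∀ a ∈ S, ∀ b ∈ S, a ≠ b → G.Adj a b),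
        (-1 : ℤ) ^ (S.card + 1) * ((q : ℤ) - 1) ^ (S.card - 1) *
          (q : ℤ) ^ ((Finset.univ.filter
            (fun w => w ∉ S ∧ ∀ s ∈ S, G.Adj s w)).card) := by
  classical
  have hq1 : 1 < q := hq ▸ Fintype.one_lt_card
  have hcast : ((q - 1 : ℕ) : ℤ) = (q : ℤ) - 1 := by push_cast [hq1.le]; rfl
  have hne : (q : ℤ) - 1 ≠ 0 := by omega
  apply mul_right_cancel₀ hne
  have h := Finset.inclusion_exclusion_card_biUnion Finset.univ (chartCone G K)
  rw [card_biUnion_chartCone, hq, Nat.cast_mul, hcast] at h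
  rw [h, Finset.sum_mul, ← Finset.filter_filter, Finset.sum_filter,
    Finset.sum_coe_sort_eq_attach, ← Finset.sum_attach (Finset.filter _ _)]
  refine Finset.sum_congr rfl fun S _ => ?_
  have hS := (Finset.mem_filter.1 S.2).2
  split_ifs with hc
  · rw [card_inf_chartCone_of_isClique G K hS hc, hq]
    push_cast
    rw [hcast]
    obtain ⟨n, hn⟩ := Nat.exists_eq_succ_of_ne_zero (Finset.card_pos.2 hS).ne'
    rw [hn, Nat.succ_sub_one, Nat.succ_eq_add_one]
    ring
  · rw [inf_chartCone_eq_empty G K hS hc]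
    simp
end

section
/- For every loose graph (G, ℓ) there exists a polynomial P ∈ ℤ[X] such that for every prime power q and finite field F_q with q elements, |S_{F_q}(G,ℓ)| = P(q). (Equivalently, the ℤ-scheme F(G,ℓ) ⊗_{F₁} ℤ is defined over F₁ in Kurokawa's sense: its number of F_q-rational points is a polynomial in q.) -/
/-- The coordinate set of a loose graph `(G, ℓ)`: the vertices together with one extra
coordinate for each loose edge. -/
abbrev Wcoord (V : Type*) (ℓ : V → ℕ) : Type _ := V ⊕ Σ v : V, Fin (ℓ v)

/-- The affine chart `A_v(G,ℓ,k)` attached to a vertex `v` of a loose graph `(G,ℓ)`: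
points of the projectivization of `Wcoord V ℓ → k` admitting a representative `x` with
`x v ≠ 0` which vanishes at every coordinate other than `v`, the `G`-neighbors of `v`,
and the loose-edge coordinates at `v`. -/
def lAchart {V : Type*} (G : SimpleGraph V) (ℓ : V → ℕ) (k : Type*) [Field k] (v : V) :
    Set (Projectivization k (Wcoord V ℓ → k)) :=
  {p | ∃ (x : Wcoord V ℓ → k) (hx : x ≠ 0), p = Projectivization.mk k x hx ∧
    x (Sum.inl v) ≠ 0 ∧
    (∀ u : V, ¬ (u = v ∨ G.Adj v u) → x (Sum.inl u) = 0) ∧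
    (∀ u : V, ∀ i : Fin (ℓ u), u ≠ v → x (Sum.inr ⟨u, i⟩) = 0)}

/-- `S_k(G,ℓ) = ⋃_{v ∈ V} A_v(G,ℓ,k)`, the set of `k`-rational points of
`F(G,ℓ) ⊗_{F₁} k`. -/
def lSpts {V : Type*} (G : SimpleGraph V) (ℓ : V → ℕ) (k : Type*) [Field k] :
    Set (Projectivization k (Wcoord V ℓ → k)) :=
  ⋃ v : V, lAchart G ℓ k v

/-- Rescaling representatives: the punctured cone over a set `S` of points of a projective space
has `|S| · |kˣ|` elements. -/
theorem ncard_punctured_cone {k E : Type*} [Field k] [AddCommGroup E] [Module k E]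
    (S : Set (Projectivization k E)) :
    {x : E | ∃ hx : x ≠ 0, Projectivization.mk k x hx ∈ S}.ncard = S.ncard * Nat.card kˣ := by
  have himage : {x : E | ∃ hx : x ≠ 0, Projectivization.mk k x hx ∈ S} =
      (fun pa : Projectivization k E × kˣ => pa.2 • pa.1.rep) '' (S ×ˢ Set.univ) := by
    ext x
    constructor
    · rintro ⟨hx, hS⟩
      obtain ⟨a, ha⟩ := Projectivization.exists_smul_eq_mk_rep k x hx
      refine ⟨(Projectivization.mk k x hx, a⁻¹), ⟨hS, Set.mem_univ _⟩, ?_⟩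
      simp [← ha]
    · rintro ⟨⟨p, a⟩, ⟨hp, -⟩, rfl⟩
      have h0 : a • p.rep ≠ 0 := (smul_ne_zero_iff_ne a).2 p.rep_nonzero
      refine ⟨h0, ?_⟩
      have : Projectivization.mk k (a • p.rep) h0 = p := by
        conv_rhs => rw [← p.mk_rep]
        exact (Projectivization.mk_eq_mk_iff k _ _ _ _).2 ⟨a, rfl⟩
      rwa [this]
  have hinj : Function.Injective
      (fun pa : Projectivization k E × kˣ => pa.2 • pa.1.rep) := by
    rintro ⟨p, a⟩ ⟨r, b⟩ h
    have h : a • p.rep = b • r.rep := h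
    have hpr : p = r := by
      rw [← p.mk_rep, ← r.mk_rep]
      refine (Projectivization.mk_eq_mk_iff k _ _ _ _).2 ⟨a⁻¹ * b, ?_⟩
      rw [mul_smul, ← h, inv_smul_smul]
    subst hpr
    have hab : (a : k) = b := smul_left_injective k p.rep_nonzero h
    rw [Units.ext hab]
  rw [himage, Set.ncard_image_of_injective _ hinj, Set.ncard_prod, Set.ncard_univ]

/-- The coordinate sets which occur as supports of homogeneous coordinates of points of
`lSpts G ℓ k`. -/
def IsChartSupport {V : Type*} (G : SimpleGraph V) (ℓ : V → ℕ) (T : Finset (Wcoord V ℓ)) : Prop :=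
  ∃ v : V, Sum.inl v ∈ T ∧ (∀ u : V, ¬ (u = v ∨ G.Adj v u) → Sum.inl u ∉ T) ∧
    (∀ u : V, ∀ i : Fin (ℓ u), u ≠ v → Sum.inr ⟨u, i⟩ ∉ T)

theorem mk_mem_lSpts_iff {V : Type*} [Fintype V] (G : SimpleGraph V) (ℓ : V → ℕ)
    {k : Type*} [Field k] [DecidableEq k] (x : Wcoord V ℓ → k) (hx : x ≠ 0) :
    Projectivization.mk k x hx ∈ lSpts G ℓ k ↔
      IsChartSupport G ℓ (Finset.univ.filter fun w => x w ≠ 0) := by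
  simp only [lSpts, lAchart, IsChartSupport, Set.mem_iUnion, Set.mem_ofPred_eq,
    Finset.mem_filter, Finset.mem_univ, true_and, not_not]
  constructor
  · rintro ⟨v, y, hy, hxy, hv, h1, h2⟩
    obtain ⟨a, rfl⟩ := (Projectivization.mk_eq_mk_iff k _ _ _ _).1 hxy
    refine ⟨v, ?_, fun u hu => ?_, fun u i hu => ?_⟩
    · simpa [Units.smul_def] using hv
    · simp [h1 u hu]
    · simp [h2 u i hu]
  · rintro ⟨v, hv, h1, h2⟩
    exact ⟨v, x, hx, rfl, hv, h1, h2⟩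

/-- Over a finite field, `(q - 1) ^ |T|` vectors have support `T`. -/
theorem card_filter_support_eq {W k : Type*} [Fintype W] [DecidableEq W] [Field k] [Fintype k]
    [DecidableEq k] (T : Finset W) :
    (Finset.univ.filter fun x : W → k => (Finset.univ.filter fun w => x w ≠ 0) = T).card =
      (Fintype.card k - 1) ^ T.card := by
  have h : (Finset.univ.filter fun x : W → k => (Finset.univ.filter fun w => x w ≠ 0) = T) =
      Fintype.piFinset fun w => if w ∈ T then Finset.univ.erase (0 : k) else {0} := by
    ext x
    simp only [Finset.mem_filter, Finset.mem_univ, true_and, Fintype.mem_piFinset,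
      Finset.ext_iff]
    refine forall_congr' fun w => ?_
    by_cases hw : w ∈ T <;> simp [hw]
  rw [h, Fintype.card_piFinset]
  simp [apply_ite Finset.card]

/-- for every loose graph `(G,ℓ)` there is a polynomial `P ∈ ℤ[X]` such that
for every finite field `F_q` with `q` elements, `|S_{F_q}(G,ℓ)| = P(q)`; i.e. the scheme
`F(G,ℓ) ⊗_{F₁} ℤ` is defined over `F₁` in Kurokawa's sense. -/
theorem stmt4 {V : Type*} [Fintype V] [DecidableEq V] (G : SimpleGraph V) (ℓ : V → ℕ) :
    ∃ P : Polynomial ℤ, ∀ (K : Type) [Field K] [Fintype K] (q : ℕ),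
      Fintype.card K = q → ((lSpts G ℓ K).ncard : ℤ) = P.eval (q : ℤ) := by
  classical
  set F : Finset (Finset (Wcoord V ℓ)) := Finset.univ.filter (IsChartSupport G ℓ) with hF
  refine ⟨∑ T ∈ F, (Polynomial.X - 1) ^ (T.card - 1), ?_⟩
  rintro K _ _ q rfl
  have hq : 1 < Fintype.card K := Fintype.one_lt_card
  have hcone : {x : Wcoord V ℓ → K | ∃ hx : x ≠ 0, Projectivization.mk K x hx ∈ lSpts G ℓ K} =
      ↑(Finset.univ.filter fun x : Wcoord V ℓ → K =>
        IsChartSupport G ℓ (Finset.univ.filter fun w => x w ≠ 0)) := by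
    ext x
    simp only [mk_mem_lSpts_iff, exists_prop, Set.mem_ofPred_eq, Finset.coe_filter,
      Finset.mem_univ, true_and, and_iff_right_iff_imp]
    rintro ⟨v, hv, -⟩ rfl
    simp at hv
  have hcount := ncard_punctured_cone (lSpts G ℓ K)
  rw [hcone, Set.ncard_coe_finset, Finset.card_eq_sum_card_fiberwise (t := F)
    (f := fun x => Finset.univ.filter fun w => x w ≠ 0) (fun x hx => by simpa [hF] using hx),
    Nat.card_eq_fintype_card, Fintype.card_units] at hcount
  have hfiber : ∀ T ∈ F, ((Finset.univ.filter fun x : Wcoord V ℓ → K =>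
      IsChartSupport G ℓ (Finset.univ.filter fun w => x w ≠ 0)).filter
        fun x => (Finset.univ.filter fun w => x w ≠ 0) = T).card =
      (Fintype.card K - 1) ^ (T.card - 1) * (Fintype.card K - 1) := by
    intro T hT
    have hT' : IsChartSupport G ℓ T := by simpa [hF] using hT
    obtain ⟨v, hv, -⟩ := id hT'
    rw [← pow_succ, Nat.sub_add_cancel (Finset.card_pos.2 ⟨_, hv⟩), ← card_filter_support_eq T,
      Finset.filter_filter]
    congr 1
    refine Finset.filter_congr fun x _ => and_iff_right_of_imp ?_
    rintro rfl
    exact hT'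
  rw [Finset.sum_congr rfl hfiber, ← Finset.sum_mul] at hcount
  rw [← Nat.eq_of_mul_eq_mul_right (by lia) hcount]
  simp [Polynomial.eval_finsetSum, Nat.cast_sub hq.le]
end

section
/- Let (T, ℓ) be a loose tree: T is a finite tree (connected acyclic simple graph) with vertex set V and ℓ : V → ℕ, such that every vertex has degree deg_T(v) + ℓ(v) ≥ 1. Let 1 < d_1 < d_2 < ⋯ < d_m be the degrees greater than 1 occurring in (T, ℓ), let n_i be the number of vertices of degree d_i, let I = (Σ_{i=1}^m n_i) − 1, and let E be the number of vertices of degree 1 (the end points). Then for every finite field F_q, |S_{F_q}(T,ℓ)| = Σ_{i=1}^m n_i q^{d_i} − I·q + I + E. -/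
open Finset

/-- The vectors representing the points of `lAchart G ℓ k v`. -/
def chartVectors {V : Type*} (G : SimpleGraph V) (ℓ : V → ℕ) (k : Type*) [Field k] (v : V) :
    Set (Wcoord V ℓ → k) :=
  {x | x (Sum.inl v) ≠ 0 ∧
    (∀ u : V, ¬ (u = v ∨ G.Adj v u) → x (Sum.inl u) = 0) ∧
    (∀ u : V, ∀ i : Fin (ℓ u), u ≠ v → x (Sum.inr ⟨u, i⟩) = 0)}

section Field

variable {V : Type*} {G : SimpleGraph V} {ℓ : V → ℕ} {k : Type*} [Field k]

lemma ne_zero_of_mem_chartVectors {v : V} {x : Wcoord V ℓ → k}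
    (hx : x ∈ chartVectors G ℓ k v) : x ≠ 0 := by
  rintro rfl
  exact hx.1 rfl

lemma mk_mem_lAchart_iff {v : V} {x : Wcoord V ℓ → k} (hx : x ≠ 0) :
    Projectivization.mk k x hx ∈ lAchart G ℓ k v ↔ x ∈ chartVectors G ℓ k v := by
  constructor
  · rintro ⟨y, hy, hxy, h₁, h₂, h₃⟩
    obtain ⟨a, rfl⟩ := (Projectivization.mk_eq_mk_iff k _ _ hx hy).1 hxy
    refine ⟨?_, fun u hu ↦ ?_, fun u i hu ↦ ?_⟩
    · simpa [Units.smul_def] using h₁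
    · simp [h₂ u hu]
    · simp [h₃ u i hu]
  · rintro ⟨h₁, h₂, h₃⟩
    exact ⟨x, hx, rfl, h₁, h₂, h₃⟩

lemma mk_mem_lSpts_iff_s7 {x : Wcoord V ℓ → k} (hx : x ≠ 0) :
    Projectivization.mk k x hx ∈ lSpts G ℓ k ↔ ∃ v, x ∈ chartVectors G ℓ k v := by
  simp [lSpts, mk_mem_lAchart_iff]

lemma adj_of_mem_chartVectors {u v : V} {x : Wcoord V ℓ → k} (hu : x ∈ chartVectors G ℓ k u)
    (hv : x ∈ chartVectors G ℓ k v) (huv : u ≠ v) : G.Adj u v := by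
  by_contra h
  exact hv.1 (hu.2.1 v (by simp [huv.symm, h]))

open scoped Classical in
lemma two_mul_card_chart_eq [Fintype V] [DecidableRel G.Adj] (hG : G.CliqueFree 3)
    (x : Wcoord V ℓ → k) :
    2 * #{v | x ∈ chartVectors G ℓ k v} =
      2 * (if ∃ v, x ∈ chartVectors G ℓ k v then 1 else 0) +
        #{p : V × V | G.Adj p.1 p.2 ∧ x ∈ chartVectors G ℓ k p.1 ∧ x ∈ chartVectors G ℓ k p.2} := by
  set C : Finset V := {v | x ∈ chartVectors G ℓ k v} with hC
  have hpairs : ({p : V × V | G.Adj p.1 p.2 ∧ x ∈ chartVectors G ℓ k p.1 ∧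
      x ∈ chartVectors G ℓ k p.2} : Finset (V × V)) = C.offDiag := by
    ext ⟨u, v⟩
    simp only [mem_filter, mem_univ, true_and, mem_offDiag, hC]
    exact ⟨fun h ↦ ⟨h.2.1, h.2.2, h.1.ne⟩,
      fun h ↦ ⟨adj_of_mem_chartVectors h.1 h.2.1 h.2.2, h.1, h.2.1⟩⟩
  have hclique : G.IsClique C := fun u hu v hv huv ↦
    adj_of_mem_chartVectors (by simpa [hC] using hu) (by simpa [hC] using hv) huv
  have hcard : #C < 3 := by
    by_contra! h
    exact hG.mono h C ⟨hclique, rfl⟩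
  have hex : (∃ v, x ∈ chartVectors G ℓ k v) ↔ 0 < #C := by
    simp [card_pos, hC, Finset.Nonempty]
  rw [hpairs, offDiag_card, if_congr hex rfl rfl]
  interval_cases #C <;> simp

end Field

lemma Projectivization.card_setOf_mk_mem {k W : Type*} [Field k] [AddCommGroup W] [Module k W]
    (S : Set (Projectivization k W)) :
    Nat.card {x : W // ∃ hx : x ≠ 0, Projectivization.mk k x hx ∈ S} =
      S.ncard * Nat.card kˣ := by
  let e := Projectivization.nonZeroEquivProjectivizationProdUnits k W
  have he (x : {v : W // v ≠ 0}) : (e x).1 = Projectivization.mk k x.1 x.2 := rfl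
  rw [← Nat.card_coe_set_eq, ← Nat.card_prod]
  refine Nat.card_congr (Equiv.trans (Equiv.subtypeSubtypeEquivSubtypeExists (fun x : W ↦ x ≠ 0)
    fun x ↦ Projectivization.mk k x.1 x.2 ∈ S).symm ?_)
  refine (e.subtypeEquiv (q := fun p ↦ p.1 ∈ S) fun x ↦ by rw [he]).trans ?_
  exact ⟨fun p ↦ (⟨p.1.1, p.2⟩, p.1.2), fun p ↦ ⟨(p.1.1, p.2), p.1.2⟩, fun _ ↦ rfl, fun _ ↦ rfl⟩

section Count

variable {V : Type*} [Fintype V] [DecidableEq V] {G : SimpleGraph V} [DecidableRel G.Adj]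
  {ℓ : V → ℕ} {k : Type*} [Field k] [Fintype k]

open scoped Classical in
lemma card_chartVectors (v : V) :
    #{x | x ∈ chartVectors G ℓ k v} =
      (Fintype.card k - 1) * Fintype.card k ^ (G.degree v + ℓ v) := by
  let f : Wcoord V ℓ → Finset k := Sum.elim
    (fun u ↦ if u = v then univ.erase 0 else if G.Adj v u then univ else {0})
    (fun p ↦ if p.1 = v then univ else {0})
  have h : ({x | x ∈ chartVectors G ℓ k v} : Finset (Wcoord V ℓ → k)) = Fintype.piFinset f := by
    ext x
    simp only [mem_filter, mem_univ, true_and, Fintype.mem_piFinset, Sum.forall, Sigma.forall,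
      f, Sum.elim_inl, Sum.elim_inr]
    constructor
    · rintro ⟨h₁, h₂, h₃⟩
      refine ⟨fun u ↦ ?_, fun u i ↦ ?_⟩
      · split_ifs with hu hu'
        · simpa [hu] using h₁
        · simp
        · simpa using h₂ u (by tauto)
      · split_ifs with hu
        · simp
        · simpa using h₃ u i hu
    · rintro ⟨h₁, h₂⟩
      refine ⟨?_, fun u hu ↦ ?_, fun u i hu ↦ ?_⟩
      · simpa using h₁ v
      · push Not at hu
        simpa [hu] using h₁ u
      · simpa [hu] using h₂ u i
  rw [h, Fintype.card_piFinset, Fintype.prod_sum_type, Fintype.prod_sigma, pow_add, ← mul_assoc]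
  congr 1
  · rw [← mul_prod_erase univ _ (mem_univ v)]
    congr 1
    · simp [f]
    · rw [← G.card_neighborFinset_eq_degree, ← prod_const]
      rw [← prod_subset (s₁ := G.neighborFinset v)]
      · refine prod_congr rfl fun u hu ↦ ?_
        rw [SimpleGraph.mem_neighborFinset] at hu
        simp [f, hu, hu.ne']
      · intro u hu
        rw [SimpleGraph.mem_neighborFinset] at hu
        simp [hu.ne']
      · intro u hu hu'
        rw [SimpleGraph.mem_neighborFinset] at hu'
        simp [f, hu', ne_of_mem_erase hu]
  · rw [prod_eq_single v]
    · simp [f]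
    · intro u _ hu
      simp [f, hu]
    · simp

open scoped Classical in
lemma card_chartVectors_inter (hG : G.CliqueFree 3) {u v : V} (huv : G.Adj u v) :
    #{x | x ∈ chartVectors G ℓ k u ∧ x ∈ chartVectors G ℓ k v} = (Fintype.card k - 1) ^ 2 := by
  let f : Wcoord V ℓ → Finset k := Sum.elim
    (fun w ↦ if w = u ∨ w = v then univ.erase 0 else {0}) (fun _ ↦ {0})
  have h : ({x | x ∈ chartVectors G ℓ k u ∧ x ∈ chartVectors G ℓ k v} :
      Finset (Wcoord V ℓ → k)) = Fintype.piFinset f := by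
    ext x
    simp only [mem_filter, mem_univ, true_and, Fintype.mem_piFinset, Sum.forall, Sigma.forall,
      f, Sum.elim_inl, Sum.elim_inr]
    constructor
    · rintro ⟨⟨h₁, h₂, h₃⟩, h₁', h₂', h₃'⟩
      refine ⟨fun w ↦ ?_, fun w i ↦ ?_⟩
      · split_ifs with hw
        · rcases hw with rfl | rfl <;> simpa
        · rw [mem_singleton]
          push Not at hw
          by_cases hwu : G.Adj u w
          · refine h₂' w fun hwv ↦ hG {u, v, w} ?_
            exact SimpleGraph.is3Clique_triple_iff.2 ⟨huv, hwu, hwv.resolve_left hw.2⟩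
          · exact h₂ w (by tauto)
      · rw [mem_singleton]
        by_cases hw : w = u
        · exact h₃' w i (hw ▸ huv.ne)
        · exact h₃ w i hw
    · rintro ⟨h₁, h₂⟩
      have hz (w : V) (hwu : w ≠ u) (hwv : w ≠ v) : x (Sum.inl w) = 0 := by
        simpa [hwu, hwv] using h₁ w
      refine ⟨⟨?_, fun w hw ↦ ?_, fun w i _ ↦ by simpa using h₂ w i⟩,
        ?_, fun w hw ↦ ?_, fun w i _ ↦ by simpa using h₂ w i⟩
      · simpa using h₁ u
      · push Not at hw
        exact hz w hw.1 (by rintro rfl; exact hw.2 huv)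
      · simpa using h₁ v
      · push Not at hw
        exact hz w (by rintro rfl; exact hw.2 huv.symm) hw.1
  rw [h, Fintype.card_piFinset, Fintype.prod_sum_type]
  rw [← prod_subset (subset_univ ({u, v} : Finset V)), prod_pair huv.ne]
  · simp [f, sq]
  · intro w _ hw
    have : ¬ (w = u ∨ w = v) := by simpa using hw
    simp [f, this]

/-- Inclusion-exclusion for the charts of a triangle-free loose graph. -/
lemma card_lSpts_of_cliqueFree (hG : G.CliqueFree 3) :
    ((lSpts G ℓ k).ncard : ℤ) = ∑ v, (Fintype.card k : ℤ) ^ (G.degree v + ℓ v) -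
      #G.edgeFinset * (Fintype.card k - 1) := by
  classical
  have hk : 1 < Fintype.card k := Fintype.one_lt_card
  have hS : #{x : Wcoord V ℓ → k | ∃ v, x ∈ chartVectors G ℓ k v} =
      (lSpts G ℓ k).ncard * (Fintype.card k - 1) := by
    have h := Projectivization.card_setOf_mk_mem (lSpts G ℓ k)
    rw [Nat.card_eq_fintype_card (α := kˣ), Fintype.card_units] at h
    rw [← h, ← Fintype.card_subtype, ← Nat.card_eq_fintype_card]
    refine Nat.card_congr (Equiv.subtypeEquivRight fun x ↦ ⟨fun hx ↦ ?_, fun ⟨hx, hx'⟩ ↦ ?_⟩)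
    · have h0 : x ≠ 0 := ne_zero_of_mem_chartVectors hx.choose_spec
      exact ⟨h0, (mk_mem_lSpts_iff_s7 h0).2 hx⟩
    · exact (mk_mem_lSpts_iff_s7 hx).1 hx'
  have hsum := sum_congr rfl fun x (_ : x ∈ (univ : Finset (Wcoord V ℓ → k))) ↦
    two_mul_card_chart_eq (G := G) hG x
  rw [sum_add_distrib, ← mul_sum, ← mul_sum, ← card_filter, hS] at hsum
  have hcharts : ∑ x : Wcoord V ℓ → k, #{v | x ∈ chartVectors G ℓ k v} =
      ∑ v, (Fintype.card k - 1) * Fintype.card k ^ (G.degree v + ℓ v) := by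
    simp_rw [← card_chartVectors (G := G), card_filter]
    exact sum_comm
  have hpairs : ∑ x : Wcoord V ℓ → k, #{p : V × V | G.Adj p.1 p.2 ∧
      x ∈ chartVectors G ℓ k p.1 ∧ x ∈ chartVectors G ℓ k p.2} =
      2 * #G.edgeFinset * (Fintype.card k - 1) ^ 2 := by
    rw [← G.sum_degrees_eq_twice_card_edges, sum_mul]
    simp_rw [card_filter]
    rw [sum_comm, Fintype.sum_prod_type]
    refine sum_congr rfl fun u _ ↦ ?_
    rw [← G.card_neighborFinset_eq_degree, ← smul_eq_mul, ← sum_const,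
      SimpleGraph.neighborFinset_eq_filter, sum_filter]
    refine sum_congr rfl fun v _ ↦ ?_
    split_ifs with huv
    · rw [← card_chartVectors_inter (ℓ := ℓ) hG huv, card_filter]
      simp [huv]
    · simp [huv]
  rw [hcharts, hpairs, ← mul_sum] at hsum
  zify [hk.le] at hsum
  have hk0 : (Fintype.card k : ℤ) - 1 ≠ 0 := by
    have : (1 : ℤ) < Fintype.card k := mod_cast hk
    linarith
  refine mul_right_cancel₀ hk0 ?_
  linarith

end Count

lemma sum_degree_eq_of_cover {V R : Type*} [Fintype V] [DecidableEq V] [CommRing R] (D : V → ℕ)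
    (hD : ∀ v, 1 ≤ D v) {m : ℕ} (d : Fin m → ℕ) (hd : d.Injective) (hd1 : ∀ i, 1 < d i)
    (hcover : ∀ v, 1 < D v → ∃ i, D v = d i) (f : ℕ → R) :
    ∑ v, f (D v) = ∑ i, (#{v | D v = d i} : R) * f (d i) + #{v | D v = 1} * f 1 := by
  have h (v : V) : f (D v) =
      ∑ i, (if D v = d i then f (d i) else 0) + if D v = 1 then f 1 else 0 := by
    rcases (hD v).eq_or_lt with h1 | h1
    · simp [← h1, (hd1 _).ne]
    · obtain ⟨i, hi⟩ := hcover v h1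
      simp [hi, hd.eq_iff, (hd1 i).ne']
  rw [sum_congr rfl fun v _ ↦ h v, sum_add_distrib, sum_comm]
  simp [← sum_filter]


/-- counting formula for loose trees. Let `(T,ℓ)` be a loose tree all of whose
vertices have degree `deg_T(v) + ℓ(v) ≥ 1`, let `1 < d 0 < … < d (m-1)` be the degrees
`> 1` occurring in `(T,ℓ)`, `n i` the number of vertices of degree `d i`,
`I = (Σ n i) − 1`, and `E` the number of vertices of degree `1`. Then for every finite
field `F_q`, `|S_{F_q}(T,ℓ)| = Σ_i n i · q^{d i} − I·q + I + E`. -/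
theorem stmt7 {V : Type*} [Fintype V] [DecidableEq V] (T : SimpleGraph V)
    [DecidableRel T.Adj] (hT : T.IsTree) (ℓ : V → ℕ)
    (hdeg : ∀ v : V, 1 ≤ T.degree v + ℓ v)
    (m : ℕ) (d n : Fin m → ℕ)
    (hmono : StrictMono d) (hd1 : ∀ i, 1 < d i)
    (hn : ∀ i, n i = (Finset.univ.filter (fun v : V => T.degree v + ℓ v = d i)).card)
    (hocc : ∀ i, 0 < n i)
    (hcover : ∀ v : V, 1 < T.degree v + ℓ v → ∃ i, T.degree v + ℓ v = d i)
    (E : ℕ) (hE : E = (Finset.univ.filter (fun v : V => T.degree v + ℓ v = 1)).card)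
    (I : ℤ) (hI : I = (∑ i, (n i : ℤ)) - 1) :
    ∀ (K : Type) [Field K] [Fintype K] (q : ℕ), Fintype.card K = q →
      ((lSpts T ℓ K).ncard : ℤ) =
        (∑ i, (n i : ℤ) * (q : ℤ) ^ (d i)) - I * (q : ℤ) + I + E := by
  rintro K _ _ q rfl
  have hfree : T.CliqueFree 3 := hT.isAcyclic.colorable_two.cliqueFree (by norm_num)
  have hedges := hT.card_edgeFinset
  have hpow := sum_degree_eq_of_cover (R := ℤ) _ hdeg d hmono.injective hd1 hcover
    (fun j ↦ (Fintype.card K : ℤ) ^ j)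
  have hone := sum_degree_eq_of_cover (R := ℤ) _ hdeg d hmono.injective hd1 hcover (fun _ ↦ 1)
  simp only [← hn, ← hE, pow_one, mul_one, sum_const, card_univ, nsmul_eq_mul] at hpow hone
  rw [card_lSpts_of_cliqueFree hfree, hpow, hI]
  zify at hedges
  have hedges' : (#T.edgeFinset : ℤ) = (∑ i, (n i : ℤ)) + E - 1 := by linarith
  rw [hedges']
  ring
end

section
/- Let Γ be a finite connected simple graph with vertex set V and let k be a field. Define Ā_v(Γ,k) := { p ∈ ℙ(k^V) : p has a representative x with x_w = 0 for all w ∉ N[v] } (the closure of the chart A_v). Then ⋃_{v∈V} Ā_v(Γ,k) = S_k(Γ) if and only if Γ is a complete graph; and in that case S_k(Γ) = ℙ(k^V). (This is the set-theoretic content of the theorem that if the scheme F(Γ) ⊗_{F₁} ℤ attached to a connected loose graph is a projective variety, then Γ is a complete graph and the scheme is a projective space.) -/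
/-- The closure chart `Ā_v(Γ,k)`: points admitting a representative supported on the
closed neighborhood `N[v]`. -/
def Acl {V : Type*} (G : SimpleGraph V) (k : Type*) [Field k] (v : V) :
    Set (Projectivization k (V → k)) :=
  {p | ∃ (x : V → k) (hx : x ≠ 0), p = Projectivization.mk k x hx ∧
    ∀ w : V, ¬ (w = v ∨ G.Adj v w) → x w = 0}

open Projectivization in
/-- If every closure chart is contained in the union of the affine charts, then two distinct
neighbours of a vertex are adjacent. -/
theorem adj_of_common_neighbor {V : Type*} [DecidableEq V] {G : SimpleGraph V} {k : Type*}
    [Field k] (h : (⋃ v : V, Acl G k v) ⊆ Spts G k) {u v w : V} (hu : G.Adj v u)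
    (hw : G.Adj v w) (huw : u ≠ w) : G.Adj u w := by
  let x : V → k := fun t => if t = u ∨ t = w then 1 else 0
  have hx : x ≠ 0 := fun h0 => by simpa [x] using congrFun h0 u
  have hmem : mk k x hx ∈ ⋃ v : V, Acl G k v := by
    refine Set.mem_iUnion.2 ⟨v, x, hx, rfl, fun t ht => if_neg ?_⟩
    rintro (rfl | rfl)
    · exact ht (Or.inr hu)
    · exact ht (Or.inr hw)
  obtain ⟨z, y, hy, hxy, hz, hsupp⟩ := Set.mem_iUnion.1 (h hmem)
  obtain ⟨a, ha⟩ := (mk_eq_mk_iff' k x y hx hy).1 hxy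
  have hN : ∀ t, t = u ∨ t = w → t = z ∨ G.Adj z t := by
    intro t ht
    by_contra hn
    have hxt := congrFun ha t
    simp [x, ht, hsupp t hn] at hxt
  have ha0 : a ≠ 0 := by
    rintro rfl
    exact hx (by rw [← ha, zero_smul])
  have hzuw : z = u ∨ z = w := by
    by_contra hn
    have hxz := congrFun ha z
    simp [x, hn, ha0, hz] at hxz
  rcases hzuw with rfl | rfl
  · exact (hN w (Or.inr rfl)).resolve_left huw.symm
  · exact ((hN u (Or.inl rfl)).resolve_left huw).symm

/-- A connected graph in which any two distinct neighbours of a vertex are adjacent is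
complete. -/
theorem SimpleGraph.Connected.eq_top_of_adj_of_common_neighbor {V : Type*} {G : SimpleGraph V}
    (hconn : G.Connected)
    (h : ∀ ⦃u v w : V⦄, G.Adj v u → G.Adj v w → u ≠ w → G.Adj u w) : G = ⊤ := by
  have key : ∀ {a b : V}, G.Walk a b → a ≠ b → G.Adj a b := by
    intro a b p
    induction p with
    | nil => exact fun hne => absurd rfl hne
    | @cons a c b hac _ ih =>
      intro hne
      by_cases hcb : c = b
      · exact hcb ▸ hac
      · exact h hac.symm (ih hcb) hne
  ext a b
  obtain ⟨p⟩ := hconn.preconnected a b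
  exact ⟨fun hab => hab.ne, fun hab => key p hab⟩

theorem Spts_subset_iUnion_Acl {V : Type*} (G : SimpleGraph V) (k : Type*) [Field k] :
    Spts G k ⊆ ⋃ v : V, Acl G k v :=
  Set.iUnion_mono fun _ _ ⟨x, hx, hp, _, hs⟩ => ⟨x, hx, hp, hs⟩

theorem Spts_top (V : Type*) (k : Type*) [Field k] :
    Spts (⊤ : SimpleGraph V) k = Set.univ := by
  refine Set.eq_univ_of_forall fun p => ?_
  obtain ⟨v, hv⟩ := Function.ne_iff.1 p.rep_nonzero
  refine Set.mem_iUnion.2 ⟨v, p.rep, p.rep_nonzero, p.mk_rep.symm, hv, fun w hw => ?_⟩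
  exact absurd ((eq_or_ne w v).imp_right fun hne => hne.symm) hw

/-- for a finite connected graph `Γ` and any field `k`,
`⋃_{v∈V} Ā_v(Γ,k) = S_k(Γ)` iff `Γ` is a complete graph; and in that case
`S_k(Γ) = ℙ(k^V)` is the whole projective space. -/
theorem stmt14 {V : Type*} [Fintype V] [DecidableEq V] (G : SimpleGraph V)
    (hconn : G.Connected) (k : Type*) [Field k] :
    ((⋃ v : V, Acl G k v) = Spts G k ↔ G = ⊤) ∧
      (G = ⊤ → Spts G k = Set.univ) := by
  have htop : G = ⊤ → Spts G k = Set.univ := by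
    rintro rfl
    exact Spts_top V k
  refine ⟨⟨fun h => ?_, fun h => ?_⟩, htop⟩
  · exact hconn.eq_top_of_adj_of_common_neighbor fun _ _ _ hu hw huw =>
      adj_of_common_neighbor h.subset hu hw huw
  · exact ((htop h).symm ▸ Set.subset_univ _ : _ ⊆ Spts G k).antisymm
      (Spts_subset_iUnion_Acl G k)
end

section
/- Let G be a finite connected simple graph on vertex set V with n = |V| ≥ 2, and let T be any spanning tree of G. Form the loose spanning tree (T, ℓ_T), where ℓ_T(v) = deg_G(v) − deg_T(v) for each vertex v (each deleted fundamental edge contributes one loose edge at each of its two end points, so every vertex keeps its degree from G). Then for every finite field F_q: |S_{F_q}(T, ℓ_T)| = Σ_{v∈V} q^{deg_G(v)} − (n−1)(q−1). In particular, this value is independent of the choice of the spanning tree T. -/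
section LooseGraph

open Finset

/-- Points of projective space whose coordinate `w` is nonzero and whose coordinates outside
`insert w C` vanish. -/
def coordChart {ι : Type*} (K : Type*) [Field K] (w : ι) (C : Finset ι) :
    Set (Projectivization K (ι → K)) :=
  {p | p.rep w ≠ 0 ∧ ∀ c, c ≠ w → c ∉ C → p.rep c = 0}

theorem mk_mem_coordChart {ι K : Type*} [Field K] {w : ι} {C : Finset ι} {x : ι → K}
    (hx : x ≠ 0) :
    Projectivization.mk K x hx ∈ coordChart K w C ↔
      x w ≠ 0 ∧ ∀ c, c ≠ w → c ∉ C → x c = 0 := by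
  obtain ⟨a, ha⟩ := Projectivization.exists_smul_eq_mk_rep K x hx
  simp [coordChart, ← ha, Units.smul_def]

open Classical in
theorem ncard_coordChart {ι K : Type*} [Field K] [Fintype K] {w : ι} {C : Finset ι}
    (hw : w ∉ C) : (coordChart K w C).ncard = Fintype.card K ^ #C := by
  let g : (C → K) → ι → K := fun f c ↦ if c = w then 1 else if h : c ∈ C then f ⟨c, h⟩ else 0
  have gw (f) : g f w = 1 := by simp [g]
  have g0 (f) : g f ≠ 0 := fun h ↦ by simpa [h] using gw f
  have gC (f) (c : C) : g f c = f c := by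
    have : (c : ι) ≠ w := fun h ↦ hw (h ▸ c.2)
    simp [g, this]
  have hinj : Function.Injective fun f ↦ Projectivization.mk K (g f) (g0 f) := by
    intro f f' h
    obtain ⟨a, ha⟩ := (Projectivization.mk_eq_mk_iff' K _ _ (g0 f) (g0 f')).1 h
    have ha1 : a = 1 := by simpa [gw] using congrFun ha w
    ext c
    rw [← gC f, ← gC f', ← ha, ha1, one_smul]
  have hrange : coordChart K w C = Set.range fun f ↦ Projectivization.mk K (g f) (g0 f) := by
    ext p
    constructor
    · rintro ⟨h1, h2⟩
      refine ⟨fun c ↦ (p.rep w)⁻¹ * p.rep c, ?_⟩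
      conv_rhs => rw [← p.mk_rep]
      refine (Projectivization.mk_eq_mk_iff' K _ _ _ _).2 ⟨(p.rep w)⁻¹, ?_⟩
      ext c
      by_cases hc : c = w
      · subst hc; simp [g, h1]
      · by_cases hC : c ∈ C
        · simp [g, hc, hC]
        · simp [g, hc, hC, h2 c hc hC]
    · rintro ⟨f, rfl⟩
      refine (mk_mem_coordChart _).2 ⟨by simp [gw], fun c hc hC ↦ by simp [g, hc, hC]⟩
  rw [hrange, ← Set.image_univ, Set.ncard_image_of_injective _ hinj, Set.ncard_univ,
    Nat.card_eq_fintype_card, Fintype.card_fun, Fintype.card_coe]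

/-- The points with exactly the two nonzero coordinates `v` and `w`. -/
theorem ncard_coordChart_singleton_inter {ι K : Type*} [Finite ι] [Field K] [Fintype K]
    {v w : ι} (h : v ≠ w) :
    ((coordChart K v {w} ∩ coordChart K w {v}).ncard : ℤ) = Fintype.card K - 1 := by
  have hsub : coordChart K v ∅ ⊆ coordChart K v {w} := fun p hp ↦
    ⟨hp.1, fun c hc _ ↦ hp.2 c hc (by simp)⟩
  have heq : coordChart K v {w} ∩ coordChart K w {v} = coordChart K v {w} \ coordChart K v ∅ := by
    ext p
    simp only [coordChart, Set.mem_inter_iff, Set.mem_sdiff, Set.mem_ofPred_eq]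
    simp only [mem_singleton, notMem_empty]
    grind
  have hle := Set.ncard_sdiff_add_ncard_of_subset hsub
    (Set.finite_of_ncard_ne_zero (by rw [ncard_coordChart (by simpa using h)]; simp))
  rw [ncard_coordChart (by simp), ncard_coordChart (by simpa using h)] at hle
  simp only [card_empty, pow_zero, card_singleton, pow_one] at hle
  rw [heq]
  omega

/-- Inclusion-exclusion for a family in which no point lies in three distinct members. -/
theorem two_mul_ncard_iUnion {V α : Type*} [Fintype V] [DecidableEq V] [Finite α]
    (A : V → Set α)
    (hA : ∀ p u v w, p ∈ A u → p ∈ A v → p ∈ A w → u = v ∨ u = w ∨ v = w) :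
    2 * ((⋃ v, A v).ncard : ℤ) =
      2 * ∑ v, ((A v).ncard : ℤ) - ∑ v, ∑ w ∈ univ.erase v, ((A v ∩ A w).ncard : ℤ) := by
  classical
  have := Fintype.ofFinite α
  have hcard (s : Set α) : (s.ncard : ℤ) = ∑ p : α, s.indicator 1 p := by
    rw [Set.ncard_eq_toFinset_card']
    simp [Set.indicator_apply]
  simp only [hcard]
  simp_rw [sum_comm (s := univ.erase _) (t := (univ : Finset α))]
  rw [sum_comm, sum_comm (s := (univ : Finset V)), mul_sum, mul_sum, ← sum_sub_distrib]
  refine sum_congr rfl fun p _ ↦ ?_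
  set c : Finset V := univ.filter fun v ↦ p ∈ A v with hc
  have h1 : (∑ v, (A v).indicator (1 : α → ℤ) p) = #c := by
    simp [hc, Set.indicator_apply]
  have h2 : (∑ v, ∑ w ∈ univ.erase v, (A v ∩ A w).indicator (1 : α → ℤ) p) =
      #c * (#c - 1) := by
    have (v : V) : (∑ w ∈ univ.erase v, (A v ∩ A w).indicator (1 : α → ℤ) p) =
        if p ∈ A v then (#c : ℤ) - 1 else 0 := by
      rw [← h1, ← sum_erase_add _ _ (mem_univ v)]
      by_cases hv : p ∈ A v <;> simp [hv, Set.indicator_apply]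
    simp only [this]
    rw [← sum_filter, ← hc, sum_const, nsmul_eq_mul]
  rw [h1, h2]
  have h3 : #c ≤ 2 := by
    by_contra! h
    obtain ⟨u, v, w, hu, hv, hw, huv, huw, hvw⟩ := two_lt_card_iff.1 h
    simp only [hc, mem_filter, mem_univ, true_and] at hu hv hw
    grind
  have h4 : (∃ v, p ∈ A v) ↔ #c ≠ 0 := by
    simp [hc, filter_eq_empty_iff]
  simp only [Set.indicator_apply, Set.mem_iUnion, h4]
  interval_cases #c <;> simp

/-- The coordinates other than `v` that may be nonzero on `A_v`. -/
def chartCoords {V : Type*} (G : SimpleGraph V) (ℓ : V → ℕ) (v : V)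
    [Fintype (G.neighborSet v)] : Finset (Wcoord V ℓ) :=
  (G.neighborFinset v).disjSum (univ.map (Function.Embedding.sigmaMk v))

theorem card_chartCoords {V : Type*} (G : SimpleGraph V) (ℓ : V → ℕ) (v : V)
    [Fintype (G.neighborSet v)] : #(chartCoords G ℓ v) = G.degree v + ℓ v := by
  simp [chartCoords]

theorem inl_mem_chartCoords {V : Type*} {G : SimpleGraph V} {ℓ : V → ℕ} {u v : V}
    [Fintype (G.neighborSet v)] : Sum.inl u ∈ chartCoords G ℓ v ↔ G.Adj v u := by
  simp [chartCoords]

theorem inr_mem_chartCoords {V : Type*} {G : SimpleGraph V} {ℓ : V → ℕ} {u v : V}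
    {i : Fin (ℓ u)} [Fintype (G.neighborSet v)] :
    Sum.inr ⟨u, i⟩ ∈ chartCoords G ℓ v ↔ u = v := by
  simp only [chartCoords, inr_mem_disjSum, mem_map, mem_univ, true_and,
    Function.Embedding.sigmaMk_apply]
  constructor
  · rintro ⟨j, h⟩
    exact (congrArg Sigma.fst h).symm
  · rintro rfl
    exact ⟨i, rfl⟩

theorem lAchart_eq_coordChart {V : Type*} (G : SimpleGraph V) (ℓ : V → ℕ) (K : Type*) [Field K]
    (v : V) [Fintype (G.neighborSet v)] :
    lAchart G ℓ K v = coordChart K (Sum.inl v) (chartCoords G ℓ v) := by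
  have key (x : Wcoord V ℓ → K) : (∀ c, c ≠ Sum.inl v → c ∉ chartCoords G ℓ v → x c = 0) ↔
      (∀ u : V, ¬ (u = v ∨ G.Adj v u) → x (Sum.inl u) = 0) ∧
        ∀ u : V, ∀ i : Fin (ℓ u), u ≠ v → x (Sum.inr ⟨u, i⟩) = 0 := by
    simp only [Sum.forall, Sigma.forall, inl_mem_chartCoords, inr_mem_chartCoords, not_or,
      and_imp, ne_eq, Sum.inl.injEq, reduceCtorEq, not_false_eq_true, forall_const]
  ext p
  constructor
  · rintro ⟨x, hx, rfl, h1, h2⟩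
    exact (mk_mem_coordChart hx).2 ⟨h1, (key x).2 h2⟩
  · rintro ⟨h1, h2⟩
    exact ⟨p.rep, p.rep_nonzero, p.mk_rep.symm, h1, (key _).1 h2⟩

theorem adj_of_mem_lAchart {V K : Type*} [Field K] {G : SimpleGraph V} {ℓ : V → ℕ} {v w : V}
    [Fintype (G.neighborSet v)] [Fintype (G.neighborSet w)]
    {p : Projectivization K (Wcoord V ℓ → K)}
    (hv : p ∈ lAchart G ℓ K v) (hw : p ∈ lAchart G ℓ K w) (hne : v ≠ w) : G.Adj v w := by
  rw [lAchart_eq_coordChart] at hv hw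
  by_contra h
  exact hw.1 (hv.2 _ (by simpa using hne.symm) (by simpa [inl_mem_chartCoords] using h))

theorem SimpleGraph.IsAcyclic.not_adj_of_adj_adj {V : Type*} {G : SimpleGraph V}
    (hG : G.IsAcyclic) {u v w : V} (huv : G.Adj u v) (hvw : G.Adj v w) : ¬ G.Adj w u := by
  intro hwu
  refine hG (.cons huv (.cons hvw (.cons hwu .nil))) ?_
  simp [SimpleGraph.Walk.isCycle_def, SimpleGraph.Walk.isTrail_def, huv.ne, hvw.ne, hwu.ne,
    huv.ne', hwu.ne']

theorem lAchart_inter_eq {V K : Type*} [Field K] {G : SimpleGraph V} (hG : G.IsAcyclic)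
    {ℓ : V → ℕ} {v w : V} [Fintype (G.neighborSet v)] [Fintype (G.neighborSet w)]
    (h : G.Adj v w) :
    lAchart G ℓ K v ∩ lAchart G ℓ K w =
      coordChart K (Sum.inl v) {Sum.inl w} ∩ coordChart K (Sum.inl w) {Sum.inl v} := by
  simp only [lAchart_eq_coordChart]
  ext p
  constructor
  · rintro ⟨hv, hw⟩
    have key (c : Wcoord V ℓ) (hcv : c ≠ Sum.inl v) (hcw : c ≠ Sum.inl w) : p.rep c = 0 := by
      by_contra hne
      have hcv' : c ∈ chartCoords G ℓ v := by_contra fun h ↦ hne (hv.2 c hcv h)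
      have hcw' : c ∈ chartCoords G ℓ w := by_contra fun h ↦ hne (hw.2 c hcw h)
      rcases c with u | ⟨u, i⟩
      · rw [inl_mem_chartCoords] at hcv' hcw'
        exact hG.not_adj_of_adj_adj h hcw' hcv'.symm
      · rw [inr_mem_chartCoords] at hcv' hcw'
        exact h.ne (hcv'.symm.trans hcw')
    exact ⟨⟨hv.1, fun c h1 h2 ↦ key c h1 (by simpa using h2)⟩,
      ⟨hw.1, fun c h1 h2 ↦ key c (by simpa using h2) h1⟩⟩
  · rintro ⟨hv, hw⟩
    refine ⟨⟨hv.1, fun c h1 h2 ↦ hv.2 c h1 ?_⟩, ⟨hw.1, fun c h1 h2 ↦ hw.2 c h1 ?_⟩⟩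
    · rw [mem_singleton]
      rintro rfl
      exact h2 (inl_mem_chartCoords.2 h)
    · rw [mem_singleton]
      rintro rfl
      exact h2 (inl_mem_chartCoords.2 h.symm)

/-- The point count of a loose tree. -/
theorem ncard_lSpts_of_isTree {V : Type*} [Fintype V] [DecidableEq V] {T : SimpleGraph V}
    [DecidableRel T.Adj] (hT : T.IsTree) (ℓ : V → ℕ) (K : Type*) [Field K] [Fintype K] :
    ((lSpts T ℓ K).ncard : ℤ) = (∑ v, (Fintype.card K : ℤ) ^ (T.degree v + ℓ v)) -
      ((Fintype.card V : ℤ) - 1) * ((Fintype.card K : ℤ) - 1) := by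
  have hie := two_mul_ncard_iUnion (lAchart T ℓ K) (by
    intro p u v w hu hv hw
    by_contra! h
    exact hT.isAcyclic.not_adj_of_adj_adj (adj_of_mem_lAchart hu hv h.1)
      (adj_of_mem_lAchart hv hw h.2.2) (adj_of_mem_lAchart hw hu h.2.1.symm))
  have hA (v : V) : ((lAchart T ℓ K v).ncard : ℤ) =
      (Fintype.card K : ℤ) ^ (T.degree v + ℓ v) := by
    rw [lAchart_eq_coordChart, ncard_coordChart (by simp [inl_mem_chartCoords]),
      card_chartCoords, Nat.cast_pow]
  have hAA (v : V) : ∑ w ∈ univ.erase v, ((lAchart T ℓ K v ∩ lAchart T ℓ K w).ncard : ℤ) =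
      T.degree v * ((Fintype.card K : ℤ) - 1) := by
    have hsub : T.neighborFinset v ⊆ univ.erase v := fun w hw ↦ by
      simpa using ((T.mem_neighborFinset v w).1 hw).ne'
    rw [← sum_subset hsub, sum_congr rfl (g := fun _ ↦ (Fintype.card K : ℤ) - 1), sum_const,
      nsmul_eq_mul, T.card_neighborFinset_eq_degree]
    · intro w hw
      have hvw := (T.mem_neighborFinset v w).1 hw
      rw [lAchart_inter_eq hT.isAcyclic hvw,
        ncard_coordChart_singleton_inter (by simpa using hvw.ne)]
    · intro w hw hw'
      rw [Nat.cast_eq_zero, Set.ncard_eq_zero, Set.eq_empty_iff_forall_notMem]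
      rintro p ⟨hpv, hpw⟩
      exact hw' ((T.mem_neighborFinset v w).2
        (adj_of_mem_lAchart hpv hpw (ne_of_mem_erase hw).symm))
  have hdeg : (∑ v, (T.degree v : ℤ)) = 2 * ((Fintype.card V : ℤ) - 1) := by
    have h1 := T.sum_degrees_eq_twice_card_edges
    have h2 := hT.card_edgeFinset
    zify at h1 h2
    rw [h1]
    linarith
  simp only [hA, hAA, ← sum_mul, hdeg] at hie
  rw [lSpts]
  linarith

end LooseGraph

/-- let `G` be a finite connected graph on `n ≥ 2` vertices and `T ≤ G` a
spanning tree. Form the loose spanning tree `(T, ℓ_T)` with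
`ℓ_T(v) = deg_G(v) − deg_T(v)`. Then for every finite field `F_q`:
`|S_{F_q}(T, ℓ_T)| = Σ_{v} q^{deg_G(v)} − (n−1)(q−1)` — in particular, independent of the
choice of the spanning tree `T`. -/
theorem stmt15 {V : Type*} [Fintype V] [DecidableEq V] (G T : SimpleGraph V)
    [DecidableRel G.Adj] [DecidableRel T.Adj]
    (hG : G.Connected) (n : ℕ) (hn : 2 ≤ n) (hcard : Fintype.card V = n)
    (hsub : T ≤ G) (hT : T.IsTree) :
    ∀ (K : Type) [Field K] [Fintype K] (q : ℕ), Fintype.card K = q →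
      ((lSpts T (fun v => G.degree v - T.degree v) K).ncard : ℤ) =
        (∑ v : V, (q : ℤ) ^ (G.degree v)) - ((n : ℤ) - 1) * ((q : ℤ) - 1) := by
  rintro K _ _ q rfl
  rw [ncard_lSpts_of_isTree hT, hcard]
  simp only [Nat.add_sub_cancel' (SimpleGraph.degree_le_of_le hsub)]
end

section
/- (Geometrical Affection Principle.) Let G be a finite connected simple graph with vertex set V (viewed as the loose graph (G, 0) with no loose edges) and let xy be an edge of G. Let B = N[x] ∪ N[y] and let G[B] denote the induced subgraph of G on B. Then for every finite field F_q, the change in the number of points caused by resolving the edge xy is determined inside B: |S_{F_q}(G, 0)| − |S_{F_q}((G,0)_{xy})| = |S_{F_q}(G[B], 0)| − |S_{F_q}((G[B],0)_{xy})|, where (·)_{xy} denotes the resolution along the edge xy. -/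
/-- The loose-edge function of the resolution along the edge `xy`: add one loose edge at
`x` and one at `y`. -/
def resL {V : Type*} [DecidableEq V] (ℓ : V → ℕ) (x y : V) : V → ℕ :=
  fun v => ℓ v + (if v = x then 1 else 0) + (if v = y then 1 else 0)

/-- A coordinate vector satisfying the condition that defines the points of `lSpts G ℓ K`. -/
def IsStarVec {V : Type*} (G : SimpleGraph V) (ℓ : V → ℕ) {K : Type*} [Field K]
    (z : Wcoord V ℓ → K) : Prop :=
  ∃ v : V, z (Sum.inl v) ≠ 0 ∧
    (∀ u : V, ¬ (u = v ∨ G.Adj v u) → z (Sum.inl u) = 0) ∧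
    (∀ u : V, ∀ i : Fin (ℓ u), u ≠ v → z (Sum.inr ⟨u, i⟩) = 0)

theorem mk_mem_lSpts_iff_s16 {V : Type*} (G : SimpleGraph V) (ℓ : V → ℕ) {K : Type*} [Field K]
    (z : Wcoord V ℓ → K) (hz : z ≠ 0) :
    Projectivization.mk K z hz ∈ lSpts G ℓ K ↔ IsStarVec G ℓ z := by
  simp only [lSpts, Set.mem_iUnion, lAchart, Set.mem_ofPred_eq, IsStarVec]
  refine exists_congr fun v => ⟨?_, fun h => ⟨z, hz, rfl, h⟩⟩
  rintro ⟨x, hx, hp, h1, h2, h3⟩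
  obtain ⟨a, rfl⟩ := (Projectivization.mk_eq_mk_iff K z x hz hx).1 hp
  refine ⟨?_, fun u hu => ?_, fun u i hu => ?_⟩
  · simpa [Units.smul_def] using h1
  · simp [h2 u hu]
  · simp [h3 u i hu]

theorem extendByZero_injective (K : Type*) [Field K] {α β : Type*} {f : α → β}
    (hf : Function.Injective f) :
    Function.Injective (Function.ExtendByZero.linearMap K f) :=
  Function.LeftInverse.injective (g := fun z => z ∘ f) fun w => funext fun a => by
    simp [hf.extend_apply]

/-- The map of projective spaces induced by extending coordinate vectors by zero along an
injection of coordinate sets. -/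
noncomputable def projExtend (K : Type*) [Field K] {α β : Type*} (f : α → β)
    (hf : Function.Injective f) :
    Projectivization K (α → K) → Projectivization K (β → K) :=
  Projectivization.map (Function.ExtendByZero.linearMap K f) (extendByZero_injective K hf)

theorem projExtend_injective (K : Type*) [Field K] {α β : Type*} (f : α → β)
    (hf : Function.Injective f) : Function.Injective (projExtend K f hf) :=
  Projectivization.map_injective _ _

theorem mk_mem_image_projExtend {K : Type*} [Field K] {α β : Type*} (f : α → β)
    (hf : Function.Injective f) (X : Set (Projectivization K (α → K)))
    (z : β → K) (hz : z ≠ 0) :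
    Projectivization.mk K z hz ∈ projExtend K f hf '' X ↔
      (∀ c, c ∉ Set.range f → z c = 0) ∧
        ∃ h : z ∘ f ≠ 0, Projectivization.mk K (z ∘ f) h ∈ X := by
  constructor
  · rintro ⟨p, hp, he⟩
    induction p using Projectivization.ind with
    | h w hw =>
      rw [projExtend, Projectivization.map_mk] at he
      obtain ⟨a, ha⟩ := (Projectivization.mk_eq_mk_iff K _ _ _ _).1 he
      have ha' : ∀ c, (a : K) * z c = Function.extend f w 0 c := fun c => by
        simpa [Units.smul_def] using congrFun ha c
      have hw' : w = a • (z ∘ f) := by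
        ext b
        have := ha' (f b)
        rw [hf.extend_apply] at this
        simp [Units.smul_def, this]
      have hzf : z ∘ f ≠ 0 := by
        rintro h0
        exact hw (by rw [hw', h0, smul_zero])
      refine ⟨fun c hc => ?_, hzf, ?_⟩
      · have := ha' c
        rw [Function.extend_apply' _ _ _ (by simpa using hc)] at this
        simpa using this
      · rwa [(Projectivization.mk_eq_mk_iff K (z ∘ f) w hzf hw).2
          ((⟨a⁻¹, by rw [hw', inv_smul_smul]⟩))]
  · rintro ⟨h0, h, hX⟩
    refine ⟨_, hX, ?_⟩
    rw [projExtend, Projectivization.map_mk]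
    congr 1
    ext c
    by_cases hc : c ∈ Set.range f
    · obtain ⟨a, rfl⟩ := hc
      simp [hf.extend_apply]
    · rw [h0 c hc]
      simp only [Function.ExtendByZero.linearMap_apply]
      rw [Function.extend_apply' _ _ _ (by simpa using hc)]
      rfl

/-- The inclusion of the vertex coordinates into the coordinates of a loose graph. -/
def vertexCoord {V : Type*} (ℓ : V → ℕ) : Wcoord V (fun _ => 0) → Wcoord V ℓ :=
  Sum.map id fun s => s.2.elim0

theorem vertexCoord_injective {V : Type*} (ℓ : V → ℕ) :
    Function.Injective (vertexCoord ℓ) := by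
  rintro (a | ⟨_, i⟩) (b | ⟨_, j⟩) h
  · simpa [vertexCoord] using h
  · exact j.elim0
  · exact i.elim0
  · exact i.elim0

/-- The inclusion of the coordinates of a loose graph on a subset of the vertices. -/
def subCoord {V : Type*} {B : Set V} {ℓ' : B → ℕ} {ℓ : V → ℕ} (h : ∀ b : B, ℓ' b = ℓ b) :
    Wcoord B ℓ' → Wcoord V ℓ :=
  Sum.map Subtype.val fun s => ⟨s.1, Fin.cast (h s.1) s.2⟩

theorem subCoord_injective {V : Type*} {B : Set V} {ℓ' : B → ℕ} {ℓ : V → ℕ}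
    (h : ∀ b : B, ℓ' b = ℓ b) : Function.Injective (subCoord h) := by
  have h' : ℓ' = fun b : B => ℓ b := funext h
  subst h'
  rintro (a | ⟨a, i⟩) (b | ⟨b, j⟩) hab
  · simpa [subCoord, Subtype.ext_iff] using hab
  · simp [subCoord] at hab
  · simp [subCoord] at hab
  · simp only [subCoord, Sum.map_inr, Sum.inr.injEq, Sigma.mk.injEq] at hab
    obtain ⟨h1, h2⟩ := hab
    obtain rfl := Subtype.ext h1
    simpa using h2

theorem mk_mem_image_vertexCoord {V : Type*} (G : SimpleGraph V) (ℓ : V → ℕ)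
    {K : Type*} [Field K] (z : Wcoord V ℓ → K) (hz : z ≠ 0) :
    Projectivization.mk K z hz ∈
        projExtend K _ (vertexCoord_injective ℓ) '' lSpts G (fun _ => 0) K ↔
      IsStarVec G ℓ z ∧ ∀ s, z (Sum.inr s) = 0 := by
  rw [mk_mem_image_projExtend]
  simp only [mk_mem_lSpts_iff_s16]
  constructor
  · rintro ⟨h0, -, v, h1, h2, -⟩
    have h3 : ∀ s, z (Sum.inr s) = 0 := fun s => h0 _ (by
      rintro ⟨a | ⟨_, i⟩, h⟩
      · simp [vertexCoord] at h
      · exact i.elim0)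
    exact ⟨⟨v, h1, h2, fun _ _ _ => h3 _⟩, h3⟩
  · rintro ⟨⟨v, h1, h2, -⟩, h3⟩
    refine ⟨?_, fun h => h1 (congrFun h (Sum.inl v)), v, h1, h2, fun _ i => i.elim0⟩
    rintro (c | s) hc
    · exact absurd ⟨Sum.inl c, rfl⟩ hc
    · exact h3 s

theorem isStarVec_comp_subCoord_iff {V : Type*} {B : Set V} {ℓ' : B → ℕ} {ℓ : V → ℕ}
    (h : ∀ b : B, ℓ' b = ℓ b) {G : SimpleGraph V} {H : SimpleGraph B}
    (hH : ∀ a b : B, H.Adj a b ↔ G.Adj a b) {K : Type*} [Field K] {z : Wcoord V ℓ → K}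
    (hz : ∀ c, c ∉ Set.range (subCoord h) → z c = 0) :
    IsStarVec H ℓ' (z ∘ subCoord h) ↔ IsStarVec G ℓ z := by
  have hl : ∀ u, u ∉ B → z (Sum.inl u) = 0 := fun u hu => hz _ (by
    rintro ⟨a | s, ha⟩
    · simp only [subCoord, Sum.map_inl, Sum.inl.injEq] at ha
      exact hu (ha ▸ a.2)
    · simp [subCoord] at ha)
  have hr : ∀ u (i : Fin (ℓ u)), u ∉ B → z (Sum.inr ⟨u, i⟩) = 0 := fun u i hu => hz _ (by
    rintro ⟨a | s, ha⟩
    · simp [subCoord] at ha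
    · simp only [subCoord, Sum.map_inr, Sum.inr.injEq, Sigma.mk.injEq] at ha
      exact hu (ha.1 ▸ s.1.2))
  constructor
  · rintro ⟨v, h1, h2, h3⟩
    refine ⟨v, h1, fun u hu => ?_, fun u i hu => ?_⟩
    · by_cases hB : u ∈ B
      · exact h2 ⟨u, hB⟩ (by simpa [hH, Subtype.ext_iff] using hu)
      · exact hl u hB
    · by_cases hB : u ∈ B
      · exact h3 ⟨u, hB⟩ (Fin.cast (h ⟨u, hB⟩).symm i) (by simpa [Subtype.ext_iff] using hu)
      · exact hr u i hB
  · rintro ⟨v, h1, h2, h3⟩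
    have hv : v ∈ B := by
      by_contra hv
      exact h1 (hl v hv)
    refine ⟨⟨v, hv⟩, h1, fun u hu => ?_, fun u i hu => ?_⟩
    · exact h2 u (by simpa [hH, Subtype.ext_iff] using hu)
    · exact h3 u _ (by simpa [Subtype.ext_iff] using hu)

theorem range_subCoord {V : Type*} {B : Set V} {ℓ' : B → ℕ} {ℓ : V → ℕ}
    (h : ∀ b : B, ℓ' b = ℓ b) :
    Set.range (subCoord h) = {c | Sum.elim id Sigma.fst c ∈ B} := by
  ext c
  constructor
  · rintro ⟨a | s, rfl⟩
    · exact a.2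
    · exact s.1.2
  · rcases c with c | ⟨c, i⟩ <;> intro hc
    · exact ⟨Sum.inl ⟨c, hc⟩, rfl⟩
    · exact ⟨Sum.inr ⟨⟨c, hc⟩, Fin.cast (h ⟨c, hc⟩).symm i⟩, rfl⟩

theorem comp_subCoord_ne_zero {V : Type*} {B : Set V} {ℓ' : B → ℕ} {ℓ : V → ℕ}
    (h : ∀ b : B, ℓ' b = ℓ b) {K : Type*} [Field K] {z : Wcoord V ℓ → K} (hz : z ≠ 0)
    (h0 : ∀ c, c ∉ Set.range (subCoord h) → z c = 0) : z ∘ subCoord h ≠ 0 := by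
  refine fun hf => hz (funext fun c => ?_)
  by_cases hc : c ∈ Set.range (subCoord h)
  · obtain ⟨a, rfl⟩ := hc
    exact congrFun hf a
  · exact h0 c hc

theorem comp_subCoord_inr_eq_zero_iff {V : Type*} {B : Set V} {ℓ' : B → ℕ} {ℓ : V → ℕ}
    (h : ∀ b : B, ℓ' b = ℓ b) {K : Type*} [Field K] {z : Wcoord V ℓ → K}
    (hz : ∀ c, c ∉ Set.range (subCoord h) → z c = 0) :
    (∀ s, (z ∘ subCoord h) (Sum.inr s) = 0) ↔ ∀ s, z (Sum.inr s) = 0 := by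
  refine ⟨fun h0 s => ?_, fun h0 s => h0 _⟩
  by_cases hs : Sum.inr s ∈ Set.range (subCoord h)
  · obtain ⟨a | t, hst⟩ := hs
    · simp [subCoord] at hst
    · rw [← hst]
      exact h0 t
  · exact hz _ hs

theorem ncard_sub_ncard_eq_ncard_diff_sub {α : Type*} [Finite α] (S T : Set α) :
    (S.ncard : ℤ) - T.ncard = (S \ T).ncard - (T \ S).ncard := by
  have h1 := Set.ncard_inter_add_ncard_sdiff_eq_ncard S T
  have h2 := Set.ncard_inter_add_ncard_sdiff_eq_ncard T S
  rw [Set.inter_comm] at h2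
  omega

/-- If `z` is a point of exactly one of a loose-edge-free graph and its resolution along `xy`,
then `z` is supported on the closed neighborhoods of `x` and `y`. -/
theorem supported_of_isStarVec_resolution {V : Type*} [DecidableEq V] {G : SimpleGraph V}
    {x y : V} {K : Type*} [Field K] {z : Wcoord V (resL (fun _ => 0) x y) → K}
    (hz : ((IsStarVec G _ z ∧ ∀ s, z (Sum.inr s) = 0) ∧
        ¬ IsStarVec (G.deleteEdges {s(x, y)}) _ z) ∨
      (IsStarVec (G.deleteEdges {s(x, y)}) _ z ∧
        ¬ (IsStarVec G _ z ∧ ∀ s, z (Sum.inr s) = 0)))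
    (c : Wcoord V (resL (fun _ => 0) x y))
    (hc : Sum.elim id Sigma.fst c ∉ insert x (G.neighborSet x) ∪ insert y (G.neighborSet y)) :
    z c = 0 := by
  have key : ∃ v, (v = x ∨ v = y) ∧ (∀ u, ¬ (u = v ∨ G.Adj v u) → z (Sum.inl u) = 0) := by
    rcases hz with ⟨⟨⟨v, h1, h2, -⟩, h0⟩, hn⟩ | ⟨⟨v, h1, h2, h3⟩, hn⟩
    · refine ⟨v, ?_, h2⟩
      by_contra hv
      refine hn ⟨v, h1, fun u hu => h2 u ?_, fun u i _ => h0 _⟩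
      rintro (h | h)
      · exact hu (Or.inl h)
      · refine hu (Or.inr ?_)
        simp only [SimpleGraph.deleteEdges_adj, Set.mem_singleton_iff, Sym2.eq_iff]
        exact ⟨h, by tauto⟩
    · have h2' : ∀ u, ¬ (u = v ∨ G.Adj v u) → z (Sum.inl u) = 0 := fun u hu => h2 u (by
        simp only [SimpleGraph.deleteEdges_adj]
        tauto)
      refine ⟨v, ?_, h2'⟩
      by_contra hv
      push Not at hv
      have h0 : ∀ s, z (Sum.inr s) = 0 := by
        rintro ⟨u, i⟩
        refine h3 u i ?_
        rintro rfl
        have : resL (fun _ => 0) x y u = 0 := by simp [resL, hv]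
        exact (Fin.cast this i).elim0
      exact hn ⟨⟨v, h1, h2', fun _ _ _ => h0 _⟩, h0⟩
  rcases c with u | ⟨u, i⟩
  · obtain ⟨v, rfl | rfl, h2⟩ := key <;> refine h2 u fun h => hc ?_
    · exact Or.inl h
    · exact Or.inr h
  · have : resL (fun _ => 0) x y u = 0 := by
      have hx : u ≠ x := by
        rintro rfl
        exact hc (Or.inl (Or.inl rfl))
      have hy : u ≠ y := by
        rintro rfl
        exact hc (Or.inr (Or.inl rfl))
      simp [resL, hx, hy]
    exact (Fin.cast this i).elim0

/-- Geometrical Affection Principle: for a finite connected graph `G`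
(viewed as a loose graph with no loose edges) with an edge `xy`, the change in the number
of `F_q`-points caused by resolving `xy` equals the corresponding change for the induced
subgraph on `B = N[x] ∪ N[y]`. -/
theorem stmt16 {V : Type*} [Fintype V] [DecidableEq V] (G : SimpleGraph V)
    (hconn : G.Connected) (x y : V) (hxy : G.Adj x y)
    (B : Set V) (hB : B = insert x (G.neighborSet x) ∪ insert y (G.neighborSet y))
    (x' y' : B) (hx' : (x' : V) = x) (hy' : (y' : V) = y) :
    ∀ (K : Type) [Field K] [Fintype K],
      ((lSpts G (fun _ => 0) K).ncard : ℤ)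
          - ((lSpts (G.deleteEdges {s(x, y)}) (resL (fun _ => 0) x y) K).ncard : ℤ)
        = ((lSpts (G.induce B) (fun _ => 0) K).ncard : ℤ)
          - ((lSpts ((G.induce B).deleteEdges {s(x', y')})
              (resL (fun _ => 0) x' y') K).ncard : ℤ) := by
  intro K _ _
  have hl : ∀ b : B, resL (fun _ => 0) x' y' b = resL (fun _ => 0) x y b := fun b => by
    simp [resL, Subtype.ext_iff, hx', hy']
  have hG : ∀ a b : B, (G.induce B).Adj a b ↔ G.Adj a b := fun _ _ => Iff.rfl
  have hG' : ∀ a b : B, ((G.induce B).deleteEdges {s(x', y')}).Adj a b ↔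
      (G.deleteEdges {s(x, y)}).Adj a b := fun a b => by
    simp [Subtype.ext_iff, hx', hy']
  have hsupp : ∀ z : Wcoord V (resL (fun _ => 0) x y) → K, _ →
      ∀ c, c ∉ Set.range (subCoord hl) → z c = 0 := fun z hz c hc =>
    supported_of_isStarVec_resolution hz c (by rwa [range_subCoord, hB] at hc)
  have e1 : projExtend K _ (subCoord_injective hl) ''
        (projExtend K _ (vertexCoord_injective _) '' lSpts (G.induce B) (fun _ => 0) K \
          lSpts ((G.induce B).deleteEdges {s(x', y')}) (resL (fun _ => 0) x' y') K) =
      projExtend K _ (vertexCoord_injective _) '' lSpts G (fun _ => 0) K \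
        lSpts (G.deleteEdges {s(x, y)}) (resL (fun _ => 0) x y) K := by
    ext p
    induction p using Projectivization.ind with
    | h z hz =>
      rw [mk_mem_image_projExtend]
      simp only [Set.mem_sdiff, mk_mem_image_vertexCoord, mk_mem_lSpts_iff_s16]
      refine (and_congr_right fun h0 => ?_).trans (and_iff_right_of_imp fun h => hsupp z (.inl h))
      rw [isStarVec_comp_subCoord_iff hl hG h0, isStarVec_comp_subCoord_iff hl hG' h0,
        comp_subCoord_inr_eq_zero_iff hl h0, exists_prop,
        and_iff_right (comp_subCoord_ne_zero hl hz h0)]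
  have e2 : projExtend K _ (subCoord_injective hl) ''
        (lSpts ((G.induce B).deleteEdges {s(x', y')}) (resL (fun _ => 0) x' y') K \
          projExtend K _ (vertexCoord_injective _) '' lSpts (G.induce B) (fun _ => 0) K) =
      lSpts (G.deleteEdges {s(x, y)}) (resL (fun _ => 0) x y) K \
        projExtend K _ (vertexCoord_injective _) '' lSpts G (fun _ => 0) K := by
    ext p
    induction p using Projectivization.ind with
    | h z hz =>
      rw [mk_mem_image_projExtend]
      simp only [Set.mem_sdiff, mk_mem_image_vertexCoord, mk_mem_lSpts_iff_s16]
      refine (and_congr_right fun h0 => ?_).trans (and_iff_right_of_imp fun h => hsupp z (.inr h))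
      rw [isStarVec_comp_subCoord_iff hl hG h0, isStarVec_comp_subCoord_iff hl hG' h0,
        comp_subCoord_inr_eq_zero_iff hl h0, exists_prop,
        and_iff_right (comp_subCoord_ne_zero hl hz h0)]
  rw [← Set.ncard_image_of_injective (lSpts G _ K)
      (projExtend_injective K _ (vertexCoord_injective (resL (fun _ => 0) x y))),
    ← Set.ncard_image_of_injective (lSpts (G.induce B) _ K)
      (projExtend_injective K _ (vertexCoord_injective (resL (fun _ => 0) x' y'))),
    ncard_sub_ncard_eq_ncard_diff_sub, ← e1, ← e2,
    Set.ncard_image_of_injective _ (projExtend_injective K _ (subCoord_injective hl)),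
    Set.ncard_image_of_injective _ (projExtend_injective K _ (subCoord_injective hl)),
    ← ncard_sub_ncard_eq_ncard_diff_sub]
end

section
/- Let (G, ℓ) be a loose graph with vertex set V, let k be a field, let A ⊆ V be a set of vertices such that ⋂_{a∈A} A_a(G,ℓ,k) = ∅, and let xy be an edge of G. Then the intersection remains empty after resolving xy: ⋂_{a∈A} A_a((G,ℓ)_{xy}, k) = ∅, where (G,ℓ)_{xy} is the resolution of (G,ℓ) along xy. -/
/-- Membership in a chart can be tested on any homogeneous-coordinate representative. -/
theorem mk_mem_lAchart_iff_s17 {V : Type*} (G : SimpleGraph V) (ℓ : V → ℕ) (k : Type*) [Field k]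
    (v : V) (z : Wcoord V ℓ → k) (hz : z ≠ 0) :
    Projectivization.mk k z hz ∈ lAchart G ℓ k v ↔
      z (Sum.inl v) ≠ 0 ∧
      (∀ u : V, ¬ (u = v ∨ G.Adj v u) → z (Sum.inl u) = 0) ∧
      (∀ u : V, ∀ i : Fin (ℓ u), u ≠ v → z (Sum.inr ⟨u, i⟩) = 0) := by
  constructor
  · rintro ⟨w, hw, hmk, hv, hinl, hinr⟩
    obtain ⟨c, rfl⟩ := (Projectivization.mk_eq_mk_iff k z w hz hw).1 hmk
    refine ⟨?_, fun u hu => ?_, fun u i hu => ?_⟩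
    · simpa [Units.smul_def] using hv
    · simp [hinl u hu]
    · simp [hinr u i hu]
  · exact fun hz' => ⟨z, hz, rfl, hz'⟩

/-- if `⋂_{a∈A} A_a(G,ℓ,k) = ∅` and `xy` is an edge of `G`, then the
intersection remains empty after resolving `(G,ℓ)` along `xy`. -/
theorem stmt17 {V : Type*} [Fintype V] [DecidableEq V] (G : SimpleGraph V) (ℓ : V → ℕ)
    (k : Type*) [Field k] (A : Set V) (x y : V) (hxy : G.Adj x y)
    (h : ⋂ a ∈ A, lAchart G ℓ k a = ∅) :
    ⋂ a ∈ A, lAchart (G.deleteEdges {s(x, y)}) (resL ℓ x y) k a = ∅ := by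
  rw [Set.eq_empty_iff_forall_notMem] at h ⊢
  intro p hp
  induction p using Projectivization.ind with | _ z hz
  simp only [Set.mem_iInter, mk_mem_lAchart_iff_s17] at hp
  rcases A.eq_empty_or_nonempty with rfl | ⟨a₀, ha₀⟩
  · exact h (Projectivization.mk k (Pi.single (Sum.inl x) 1) (by simp)) (by simp)
  · have hz' : (Sum.elim (fun u => z (Sum.inl u)) 0 : Wcoord V ℓ → k) ≠ 0 :=
      fun h0 => (hp a₀ ha₀).1 (congrFun h0 (Sum.inl a₀))
    refine h (Projectivization.mk k _ hz') ?_
    simp only [Set.mem_iInter, mk_mem_lAchart_iff_s17]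
    intro a ha
    obtain ⟨hv, hinl, -⟩ := hp a ha
    refine ⟨hv, fun u hu => hinl u ?_, fun _ _ _ => rfl⟩
    exact fun hu' => hu (hu'.imp_right fun hadj => G.deleteEdges_le _ hadj)
end

section
/- Let D be the hexahedron graph (the graph of the 3-dimensional cube: 8 vertices, 12 edges, every vertex of degree 3, bipartite with no triangles, and no two adjacent vertices having a common neighbor). Then for every finite field F_q, |S_{F_q}(D)| = 8q³ − 12q + 12; i.e., the counting polynomial of the hexahedron is 8X³ − 12X + 12. -/
theorem mk_mem_Achart {V : Type*} {G : SimpleGraph V} {k : Type*} [Field k] {v : V}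
    {x : V → k} (hx : x ≠ 0) :
    Projectivization.mk k x hx ∈ Achart G k v ↔
      x v ≠ 0 ∧ ∀ w : V, ¬ (w = v ∨ G.Adj v w) → x w = 0 := by
  refine ⟨?_, fun h => ⟨x, hx, rfl, h⟩⟩
  rintro ⟨y, hy, hxy, hyv, hyw⟩
  obtain ⟨a, rfl⟩ := (Projectivization.mk_eq_mk_iff k x y hx hy).1 hxy
  have ha : (a : k) ≠ 0 := a.ne_zero
  refine ⟨?_, fun w hw => ?_⟩
  · simpa [Units.smul_def] using hyv
  · simp [hyw w hw]

/-- A set of projective points whose representatives normalized at `v` form a box has the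
cardinality of that box. -/
theorem ncard_eq_prod_of_normalized {V : Type*} [Fintype V] [DecidableEq V] {k : Type*} [Field k]
    (S : Set (Projectivization k (V → k))) (v : V) (t : V → Finset k) (ht : t v = {1})
    (hS : ∀ (x : V → k) (hx : x ≠ 0), Projectivization.mk k x hx ∈ S → x v ≠ 0)
    (hmem : ∀ (x : V → k) (hx : x ≠ 0), x v = 1 →
      (Projectivization.mk k x hx ∈ S ↔ ∀ w, x w ∈ t w)) :
    S.ncard = ∏ w, (t w).card := by
  rw [← Fintype.card_piFinset, ← Set.ncard_coe_finset]
  have hone : ∀ x ∈ (Fintype.piFinset t : Set (V → k)), x v = 1 := fun x hx => by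
    simpa [ht] using Fintype.mem_piFinset.1 (Finset.mem_coe.1 hx) v
  have hne : ∀ x ∈ (Fintype.piFinset t : Set (V → k)), x ≠ 0 := fun x hx h => by
    simpa [h] using hone x hx
  symm
  refine Set.ncard_congr (fun x hx => Projectivization.mk k x (hne x hx)) ?_ ?_ ?_
  · intro x hx
    exact (hmem x _ (hone x hx)).2 (Fintype.mem_piFinset.1 (Finset.mem_coe.1 hx))
  · intro x y hx hy hxy
    obtain ⟨a, rfl⟩ := (Projectivization.mk_eq_mk_iff' k x y _ _).1 hxy
    have h := hone _ hx
    simp only [Pi.smul_apply, hone y hy, smul_eq_mul, mul_one] at h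
    simp [h]
  · intro p hp
    induction p using Projectivization.ind with
    | h x hx =>
      have hv := hS x hx hp
      have hx' : (x v)⁻¹ • x ≠ 0 := smul_ne_zero (inv_ne_zero hv) hx
      have heq : Projectivization.mk k ((x v)⁻¹ • x) hx' = Projectivization.mk k x hx :=
        (Projectivization.mk_eq_mk_iff' k _ _ _ _).2 ⟨_, rfl⟩
      refine ⟨(x v)⁻¹ • x, ?_, heq⟩
      rw [Finset.mem_coe, Fintype.mem_piFinset]
      exact (hmem _ hx' (by simp [hv])).1 (heq ▸ hp)

theorem ncard_Achart {V : Type*} [Fintype V] [DecidableEq V] (G : SimpleGraph V)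
    [DecidableRel G.Adj] (k : Type*) [Field k] [Fintype k] (v : V) :
    (Achart G k v).ncard = Fintype.card k ^ G.degree v := by
  classical
  rw [ncard_eq_prod_of_normalized (Achart G k v) v
    (fun w => if w = v then {1} else if G.Adj v w then Finset.univ else {0}) (by simp)
    (fun x hx h => ((mk_mem_Achart hx).1 h).1)]
  · calc _ = ∏ w, if G.Adj v w then Fintype.card k else 1 := by
          refine Finset.prod_congr rfl fun w _ => ?_
          by_cases h : w = v
          · simp [h]
          · by_cases h' : G.Adj v w <;> simp [h, h']
      _ = _ := by
          rw [Finset.prod_ite, Finset.prod_const, Finset.prod_const_one, mul_one,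
            ← G.neighborFinset_eq_filter, G.card_neighborFinset_eq_degree]
  · intro x hx hv
    rw [mk_mem_Achart]
    refine ⟨fun h w => ?_, fun h => ⟨by simp [hv], fun w hw => ?_⟩⟩
    · by_cases h1 : w = v
      · simp [h1, hv]
      · by_cases h2 : G.Adj v w
        · simp [h1, h2]
        · simpa [h1, h2] using h.2 w (by tauto)
    · have := h w
      simpa [not_or.1 hw] using this

/-- In a triangle-free graph, the charts of two adjacent vertices meet in a punctured line. -/
theorem ncard_Achart_inter {V : Type*} [Fintype V] [DecidableEq V] (G : SimpleGraph V)
    (k : Type*) [Field k] [Fintype k] {a b : V}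
    (hab : G.Adj a b) (hcn : ∀ w : V, ¬ (G.Adj a w ∧ G.Adj b w)) :
    (Achart G k a ∩ Achart G k b).ncard = Fintype.card k - 1 := by
  classical
  have hba : b ≠ a := hab.ne'
  rw [ncard_eq_prod_of_normalized (Achart G k a ∩ Achart G k b) a
    (fun w => if w = a then {1} else if w = b then {0}ᶜ else {0}) (by simp)
    (fun x hx h => ((mk_mem_Achart hx).1 h.1).1)]
  · calc _ = ∏ w, if w = b then Fintype.card k - 1 else 1 := by
          refine Finset.prod_congr rfl fun w _ => ?_
          by_cases h : w = a
          · simp [h, hba.symm]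
          · by_cases h' : w = b
            · simp [h', hba, Finset.card_compl]
            · simp [h, h']
      _ = _ := by simp
  · intro x hx hv
    rw [Set.mem_inter_iff, mk_mem_Achart, mk_mem_Achart]
    refine ⟨fun h w => ?_, fun h => ⟨⟨by simp [hv], fun w hw => ?_⟩, ?_, fun w hw => ?_⟩⟩
    · by_cases h1 : w = a
      · simp [h1, hv]
      · by_cases h2 : w = b
        · simpa [h2, hba] using h.2.1
        · have : x w = 0 := by
            by_cases h3 : G.Adj a w
            · exact h.2.2 w (by have := hcn w; tauto)
            · exact h.1.2 w (by tauto)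
          simp [h1, h2, this]
    · have h1 : w ≠ a := by tauto
      have h2 : w ≠ b := by rintro rfl; tauto
      simpa [h1, h2] using h w
    · simpa [hba] using h b
    · have h1 : w ≠ a := by rintro rfl; exact hw (Or.inr hab.symm)
      have h2 : w ≠ b := by tauto
      simpa [h1, h2] using h w

theorem adj_of_mem_Achart {V : Type*} {G : SimpleGraph V} {k : Type*} [Field k] {a b : V}
    {p : Projectivization k (V → k)} (hab : a ≠ b) (ha : p ∈ Achart G k a)
    (hb : p ∈ Achart G k b) : G.Adj a b := by
  induction p using Projectivization.ind with
  | h x hx =>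
    rw [mk_mem_Achart] at ha hb
    by_contra h
    exact hb.1 (ha.2 b (by simp [hab.symm, h]))

/-- Double counting of the incidences between points and charts of a triangle-free graph. -/
theorem two_mul_sum_ncard_Achart {V : Type*} [Fintype V] [DecidableEq V] (G : SimpleGraph V)
    [DecidableRel G.Adj] (k : Type*) [Field k] [Fintype k] (htri : G.CliqueFree 3) :
    2 * ∑ v, (Achart G k v).ncard =
      2 * (Spts G k).ncard + ∑ v, G.degree v * (Fintype.card k - 1) := by
  classical
  have : Fintype (Projectivization k (V → k)) := Fintype.ofFinite _
  set charts : Projectivization k (V → k) → Finset V :=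
    fun p => Finset.univ.filter fun v => p ∈ Achart G k v with hcharts
  have hncard : ∀ S : Set (Projectivization k (V → k)),
      S.ncard = ∑ p, if p ∈ S then 1 else 0 := fun S => by
    rw [← Finset.card_filter, ← Set.ncard_coe_finset]
    simp
  have hle : ∀ p, (charts p).card ≤ 2 := fun p => by
    by_contra! h
    obtain ⟨s, hs, hs3⟩ := Finset.exists_subset_card_eq (Nat.succ_le_of_lt h)
    refine htri s ⟨fun a ha b hb hab => ?_, hs3⟩
    exact adj_of_mem_Achart hab (Finset.mem_filter.1 (hs ha)).2 (Finset.mem_filter.1 (hs hb)).2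
  have hpoint : ∀ p, 2 * (charts p).card =
      2 * (if p ∈ Spts G k then 1 else 0) + (charts p).offDiag.card := fun p => by
    have hS : p ∈ Spts G k ↔ (charts p).card ≠ 0 := by
      simp [Spts, charts, Finset.filter_eq_empty_iff]
    have := hle p
    rw [Finset.offDiag_card]
    interval_cases h : (charts p).card <;> simp_all
  have hsum : ∑ v, (Achart G k v).ncard = ∑ p, (charts p).card := by
    simp_rw [hncard, hcharts, Finset.card_filter]
    exact Finset.sum_comm
  have hoff : ∑ p, (charts p).offDiag.card = ∑ v, G.degree v * (Fintype.card k - 1) := by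
    have hcard : ∀ p, (charts p).offDiag.card =
        ∑ a, ∑ b, if G.Adj a b then (if p ∈ Achart G k a ∩ Achart G k b then 1 else 0) else 0 :=
      fun p => by
        rw [← Finset.sum_product', Finset.univ_product_univ]
        simp_rw [← ite_and]
        rw [← Finset.card_filter]
        congr 1
        ext ⟨a, b⟩
        simp only [Finset.mem_offDiag, hcharts, Finset.mem_filter, Finset.mem_univ, true_and,
          Set.mem_inter_iff]
        exact ⟨fun h => ⟨adj_of_mem_Achart h.2.2 h.1 h.2.1, h.1, h.2.1⟩,
          fun h => ⟨h.2.1, h.2.2, h.1.ne⟩⟩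
    simp_rw [hcard]
    rw [Finset.sum_comm]
    refine Finset.sum_congr rfl fun a _ => ?_
    rw [Finset.sum_comm]
    have hb : ∀ b, (∑ p, if G.Adj a b then
        (if p ∈ Achart G k a ∩ Achart G k b then 1 else 0) else 0) =
        if G.Adj a b then Fintype.card k - 1 else 0 := fun b => by
      split_ifs with hab
      · have hcn : ∀ w, ¬ (G.Adj a w ∧ G.Adj b w) := fun w h =>
          htri {a, b, w} (SimpleGraph.is3Clique_triple_iff.2 ⟨hab, h⟩)
        rw [← ncard_Achart_inter G k hab hcn, hncard]
        congr!
      · simp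
    simp_rw [hb]
    rw [← Finset.sum_filter, Finset.sum_const, ← G.neighborFinset_eq_filter,
      G.card_neighborFinset_eq_degree, smul_eq_mul]
  rw [hsum, hncard, ← hoff, Finset.mul_sum, Finset.mul_sum, ← Finset.sum_add_distrib]
  exact Finset.sum_congr rfl fun p _ => hpoint p

/-- let `D` be the hexahedron (cube) graph: 8 vertices, 12 edges, every
vertex of degree 3, bipartite with no triangles, and no two adjacent vertices having a
common neighbor. Then for every finite field `F_q`,
`|S_{F_q}(D)| = 8q³ − 12q + 12`. -/
theorem stmt18 {V : Type*} [Fintype V] [DecidableEq V] (D : SimpleGraph V)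
    [DecidableRel D.Adj]
    (hcard : Fintype.card V = 8)
    (hedges : D.edgeFinset.card = 12)
    (hdeg : ∀ v : V, D.degree v = 3)
    (hbip : D.Colorable 2)
    (htri : D.CliqueFree 3)
    (hcn : ∀ a b : V, D.Adj a b → ∀ w : V, ¬ (D.Adj a w ∧ D.Adj b w)) :
    ∀ (K : Type) [Field K] [Fintype K] (q : ℕ), Fintype.card K = q →
      ((Spts D K).ncard : ℤ) = 8 * (q : ℤ) ^ 3 - 12 * (q : ℤ) + 12 := by
  rintro K _ _ q rfl
  have h := two_mul_sum_ncard_Achart D K htri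
  simp only [ncard_Achart, hdeg, Finset.sum_const, Finset.card_univ, hcard, smul_eq_mul] at h
  have hq : 1 ≤ Fintype.card K := Fintype.card_pos
  zify [hq] at h
  linarith
end

section
/- Let J(4,2) be the Johnson graph with parameters (4,2) (equivalently, the octahedron, i.e., the complete tripartite graph K_{2,2,2}: 6 vertices, 12 edges, each vertex adjacent to all vertices except one). Then for every finite field F_q, |S_{F_q}(J(4,2))| = 6q⁴ − 12q³ + 20q² − 16q + 8; i.e., the counting polynomial of J(4,2) is 6X⁴ − 12X³ + 20X² − 16X + 8. -/
/-- A fixed-point-free involution on a six-element type splits it into three swapped pairs. -/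
theorem exists_equiv_of_involutive_card_six {V : Type*} [Fintype V] [DecidableEq V]
    (hcard : Fintype.card V = 6) (f : V → V) (hfix : ∀ v, f v ≠ v) (hinv : ∀ v, f (f v) = v) :
    ∃ e : Fin 3 × Bool ≃ V, ∀ i s, f (e (i, s)) = e (i, !s) := by
  obtain ⟨a, -⟩ : ∃ a : V, a ∉ (∅ : Finset V) := by
    by_contra! h
    have : (Finset.univ : Finset V) ⊆ ∅ := fun v _ => h v
    have := Finset.card_le_card this
    simp [hcard] at this
  obtain ⟨b, hb⟩ : ∃ b : V, b ∉ ({a, f a} : Finset V) := by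
    by_contra! h
    have := Finset.card_le_card (fun v _ => h v : (Finset.univ : Finset V) ⊆ {a, f a})
    have := Finset.card_le_two (a := a) (b := f a)
    grind [Finset.card_univ]
  obtain ⟨c, hc⟩ : ∃ c : V, c ∉ ({a, f a, b, f b} : Finset V) := by
    by_contra! h
    have := Finset.card_le_card (fun v _ => h v : (Finset.univ : Finset V) ⊆ {a, f a, b, f b})
    have := Finset.card_le_four (a := a) (b := f a) (c := b) (d := f b)
    grind [Finset.card_univ]
  let g : Fin 3 × Bool → V := fun p => cond p.2 (f (![a, b, c] p.1)) (![a, b, c] p.1)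
  have hg : Function.Injective g := by
    rintro ⟨i, s⟩ ⟨j, t⟩ h
    simp only [Finset.mem_insert, Finset.mem_singleton, not_or] at hb hc
    fin_cases i <;> fin_cases j <;> cases s <;> cases t <;> simp [g] at h ⊢ <;> grind
  refine ⟨Equiv.ofBijective g
    ((Fintype.bijective_iff_injective_and_card g).2 ⟨hg, by simp [hcard]⟩), ?_⟩
  rintro i (_ | _) <;> simp [g, hinv]

/-- The number of pairs of field elements that are both zero or both nonzero. -/
theorem card_pairs_zero_iff_zero (K : Type*) [Field K] [Fintype K] [DecidableEq K] :
    Fintype.card {p : Bool → K // p false = 0 ↔ p true = 0} = (Fintype.card K - 1) ^ 2 + 1 := by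
  let e : {p : Bool → K // p false = 0 ↔ p true = 0} ≃ Option (Kˣ × Kˣ) :=
    { toFun := fun p => if h : p.1 false = 0 then none else
        some (Units.mk0 _ h, Units.mk0 (p.1 true) (fun h' => h (p.2.2 h')))
      invFun := fun o => o.elim ⟨0, by simp⟩ fun u => ⟨fun s => cond s u.2 u.1, by simp⟩
      left_inv := by
        rintro ⟨p, hp⟩
        by_cases h : p false = 0
        · ext s
          cases s <;> simp [h, hp.1 h]
        · ext s
          cases s <;> simp [h]
      right_inv := by
        rintro (_ | ⟨u, v⟩) <;> simp }
  rw [Fintype.card_congr e, Fintype.card_option, Fintype.card_prod, Fintype.card_units, sq]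

/-- The number of vectors whose zero set is stable under a fixed-point-free involution of a
six-element index type. -/
theorem card_vectors_zero_iff_zero {V : Type*} [Fintype V] [DecidableEq V]
    (hcard : Fintype.card V = 6) (f : V → V) (hfix : ∀ v, f v ≠ v) (hinv : ∀ v, f (f v) = v)
    (K : Type*) [Field K] [Fintype K] [DecidableEq K] :
    Fintype.card {x : V → K // ∀ v, x v = 0 ↔ x (f v) = 0} =
      ((Fintype.card K - 1) ^ 2 + 1) ^ 3 := by
  obtain ⟨e, he⟩ := exists_equiv_of_involutive_card_six hcard f hfix hinv
  have key : Fintype.card {x : V → K // ∀ v, x v = 0 ↔ x (f v) = 0} =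
      Fintype.card (Fin 3 → {p : Bool → K // p false = 0 ↔ p true = 0}) := by
    refine Fintype.card_congr (Equiv.trans (Equiv.subtypeEquiv
      ((e.symm.arrowCongr (Equiv.refl K)).trans (Equiv.curry (Fin 3) Bool K))
      (q := fun y => ∀ i, y i false = 0 ↔ y i true = 0) fun x => ?_)
      (Equiv.subtypePiEquivPi (p := fun _ (p : Bool → K) => p false = 0 ↔ p true = 0)))
    rw [← e.forall_congr_right (q := fun v => x v = 0 ↔ x (f v) = 0), Prod.forall]
    simp only [he, Bool.forall_bool]
    simp [Function.curry]
    grind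
  rw [key, Fintype.card_fun, card_pairs_zero_iff_zero, Fintype.card_fin]

open Projectivization in
/-- Every point of a projective space is represented by as many vectors as there are units. -/
theorem card_cone_eq_ncard_mul (K W : Type*) [DivisionRing K] [AddCommGroup W] [Module K W]
    (S : Set (Projectivization K W)) :
    Nat.card {w : W // ∃ h : w ≠ 0, mk K w h ∈ S} = S.ncard * Nat.card Kˣ := by
  rw [← Nat.card_coe_set_eq, ← Nat.card_prod]
  have hmk (p : Projectivization K W) (u : Kˣ) (h : u • p.rep ≠ 0) : mk K (u • p.rep) h = p := by
    conv_rhs => rw [← p.mk_rep]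
    exact (mk_eq_mk_iff K _ _ _ _).2 ⟨u, rfl⟩
  have hne (p : Projectivization K W) (u : Kˣ) : u • p.rep ≠ 0 :=
    (smul_ne_zero_iff_ne u).2 p.rep_nonzero
  symm
  refine Nat.card_congr (Equiv.ofBijective
    (fun z : S × Kˣ => ⟨z.2 • z.1.1.rep, hne _ _, by rw [hmk]; exact z.1.2⟩) ⟨?_, ?_⟩)
  · rintro ⟨⟨p, hp⟩, u⟩ ⟨⟨p', hp'⟩, u'⟩ h
    have h' : u • p.rep = u' • p'.rep := congrArg Subtype.val h
    obtain rfl : p = p' := by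
      rw [← hmk p u (hne p u), ← hmk p' u' (hne p' u')]
      simp only [h']
    have : u = u' := Units.ext (smul_left_injective K p.rep_nonzero h')
    rw [this]
  · rintro ⟨w, hw, hS⟩
    obtain ⟨a, ha⟩ := exists_smul_eq_mk_rep K w hw
    exact ⟨(⟨_, hS⟩, a⁻¹), Subtype.ext (by simp [← ha])⟩

/-- A nonzero vector represents a point of `Spts G K` when some coordinate chart contains it. -/
theorem mk_mem_Spts_iff {V : Type*} (G : SimpleGraph V) (K : Type*) [Field K]
    (x : V → K) (hx : x ≠ 0) :
    Projectivization.mk K x hx ∈ Spts G K ↔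
      ∃ v, x v ≠ 0 ∧ ∀ w, ¬ (w = v ∨ G.Adj v w) → x w = 0 := by
  simp only [Spts, Achart, Set.mem_iUnion, Set.mem_ofPred_eq]
  refine exists_congr fun v => ⟨?_, fun h => ⟨x, hx, rfl, h⟩⟩
  rintro ⟨y, hy, hxy, hv, hw⟩
  obtain ⟨a, rfl⟩ := (Projectivization.mk_eq_mk_iff K _ _ _ _).1 hxy
  exact ⟨by simpa [Units.smul_def] using hv, fun w h => by simp [hw w h]⟩

/-- let `J = J(4,2)` be the Johnson graph with parameters `(4,2)`,
equivalently the octahedron `K_{2,2,2}`: 6 vertices, each vertex adjacent to all vertices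
except exactly one (its partner under a fixed-point-free involution `f`). Then for every
finite field `F_q`, `|S_{F_q}(J(4,2))| = 6q⁴ − 12q³ + 20q² − 16q + 8`. -/
theorem stmt19 {V : Type*} [Fintype V] [DecidableEq V] (J : SimpleGraph V)
    (hcard : Fintype.card V = 6)
    (f : V → V) (hfix : ∀ v : V, f v ≠ v) (hinv : ∀ v : V, f (f v) = v)
    (hadj : ∀ a b : V, J.Adj a b ↔ a ≠ b ∧ b ≠ f a) :
    ∀ (K : Type) [Field K] [Fintype K] (q : ℕ), Fintype.card K = q →
      ((Spts J K).ncard : ℤ) =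
        6 * (q : ℤ) ^ 4 - 12 * (q : ℤ) ^ 3 + 20 * (q : ℤ) ^ 2 - 16 * (q : ℤ) + 8 := by
  intro K _ _ q hq
  classical
  have hcone (x : V → K) : (∃ h : x ≠ 0, Projectivization.mk K x h ∈ Spts J K) ↔
      ¬ ∀ v, x v = 0 ↔ x (f v) = 0 := by
    have hnon (v w : V) : ¬ (w = v ∨ J.Adj v w) ↔ w = f v := by
      rw [hadj]
      have := hfix v
      grind
    simp only [mk_mem_Spts_iff, hnon, forall_eq]
    constructor
    · rintro ⟨-, v, hv, hw⟩ h
      exact hv ((h v).2 hw)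
    · intro h
      obtain ⟨v, hv, hw⟩ : ∃ v, x v ≠ 0 ∧ x (f v) = 0 := by
        by_contra! hc
        exact h fun v => ⟨fun h0 => by_contra fun h1 => hc _ h1 (by rwa [hinv]),
          fun h0 => by_contra fun h1 => hc _ h1 h0⟩
      exact ⟨fun h0 => hv (by simp [h0]), v, hv, hw⟩
  have hcount := card_cone_eq_ncard_mul K (V → K) (Spts J K)
  have htotal := Fintype.card_subtype_compl fun x : V → K => ∀ v, x v = 0 ↔ x (f v) = 0
  have hle := Fintype.card_subtype_le fun x : V → K => ∀ v, x v = 0 ↔ x (f v) = 0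
  simp only [hcone, Nat.card_eq_fintype_card, Fintype.card_units] at hcount
  rw [hcount] at htotal
  rw [card_vectors_zero_iff_zero hcard f hfix hinv K] at htotal hle
  simp only [Fintype.card_fun, hcard, hq] at htotal hle
  have hq1 : 1 < q := hq ▸ Fintype.one_lt_card
  zify [hle, hq1.le] at htotal
  have hq0 : (q : ℤ) - 1 ≠ 0 := by omega
  refine mul_right_cancel₀ hq0 (htotal.trans ?_)
  ring
end
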